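/- arXiv:1810.09748 — 4 statements merged into one kernel-verified Lean document; each statement's English description precedes it below -/
import Mathlib

section
/- Let μ be a compactly supported complex Borel measure on ℂ with μ(ℂ) ≠ 0 satisfying μ(ℂ) · ∫ zⁿ conj(z)ᵐ dμ = (∫ zⁿ dμ)(∫ conj(z)ᵐ dμ) for all m, n ∈ ℕ. Then μ = μ(ℂ) · δ_ζ where ζ = (∫ z dμ(z)) / μ(ℂ). -/
open MeasureTheory Complex
open scoped Classical

/-- The Stone–Weierstrass theorem on a compact subset of an arbitrary space. -/
theorem exists_mem_starSubalgebra_near_of_isCompact {X : Type*} [TopologicalSpace X]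
    {A : StarSubalgebra ℂ C(X, ℂ)} (hA : A.SeparatesPoints) (f : C(X, ℂ)) {K : Set X}
    (hK : IsCompact K) {ε : ℝ} (hε : 0 < ε) : ∃ g ∈ A, ∀ x ∈ K, ‖f x - g x‖ < ε := by
  have : CompactSpace K := isCompact_iff_compactSpace.mp hK
  let ρ : C(X, ℂ) →⋆ₐ[ℂ] C(K, ℂ) :=
    ContinuousMap.compStarAlgHom' ℂ ℂ ⟨Subtype.val, continuous_subtype_val⟩
  have hsep : (A.map ρ).SeparatesPoints := by
    intro x y hxy
    obtain ⟨_, ⟨g, hg, rfl⟩, hne⟩ := hA (fun h => hxy (Subtype.ext h))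
    exact ⟨_, ⟨ρ g, ⟨g, hg, rfl⟩, rfl⟩, hne⟩
  have hmem : ρ f ∈ (A.map ρ).topologicalClosure := by
    rw [ContinuousMap.starSubalgebra_topologicalClosure_eq_top_of_separatesPoints _ hsep]
    trivial
  obtain ⟨_, ⟨g, hg, rfl⟩, hlt⟩ := Metric.mem_closure_iff.mp hmem ε hε
  refine ⟨g, hg, fun x hx => ?_⟩
  rw [dist_eq_norm, ContinuousMap.norm_lt_iff _ hε] at hlt
  exact hlt ⟨x, hx⟩

theorem integrable_mul_of_ae_mem_isCompact {X : Type*} [TopologicalSpace X] [MeasurableSpace X]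
    [OpensMeasurableSpace X] {Q : Measure X} [IsFiniteMeasure Q] {K : Set X} (hK : IsCompact K)
    (hQ : ∀ᵐ x ∂Q, x ∈ K) {f H : X → ℂ} (hf : Continuous f) (hH : Measurable H)
    (hnorm : ∀ x, ‖H x‖ = 1) : Integrable (fun x => f x * H x) Q := by
  obtain ⟨C, hC⟩ := hK.exists_bound_of_continuousOn hf.continuousOn
  refine Integrable.of_bound (hf.measurable.mul hH).aestronglyMeasurable C ?_
  filter_upwards [hQ] with x hx
  rw [norm_mul, hnorm, mul_one]
  exact hC x hx

section Uniqueness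

variable {Ω X : Type*} [MeasurableSpace Ω] [PseudoMetricSpace X] [MeasurableSpace X] [BorelSpace X]
  {Q : Measure Ω} [IsFiniteMeasure Q] {Φ : Ω → X} {K : Set X} {F : Ω → ℂ} {C : ℝ}
  {A : StarSubalgebra ℂ C(X, ℂ)}

theorem integral_comp_mul_eq_zero_of_separatesPoints (hΦ : Measurable Φ) (hK : IsCompact K)
    (hQ : ∀ᵐ x ∂Q, Φ x ∈ K) (hF : Measurable F) (hFC : ∀ᵐ x ∂Q, ‖F x‖ ≤ C)
    (hA : A.SeparatesPoints) (hzero : ∀ g ∈ A, ∫ x, g (Φ x) * F x ∂Q = 0) (f : C(X, ℂ)) :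
    ∫ x, f (Φ x) * F x ∂Q = 0 := by
  have hFint : Integrable F Q := Integrable.of_bound hF.aestronglyMeasurable C hFC
  have hint (g : C(X, ℂ)) : Integrable (fun x => g (Φ x) * F x) Q := by
    obtain ⟨D, hD⟩ := hK.exists_bound_of_continuousOn g.continuous.continuousOn
    refine hFint.bdd_mul (g.continuous.measurable.comp hΦ).aestronglyMeasurable (c := D) ?_
    filter_upwards [hQ] with x hx using hD _ hx
  have hbound (ε : ℝ) (hε : 0 < ε) : ‖∫ x, f (Φ x) * F x ∂Q‖ ≤ ε * ∫ x, ‖F x‖ ∂Q := by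
    obtain ⟨g, hg, hfg⟩ := exists_mem_starSubalgebra_near_of_isCompact hA f hK hε
    rw [← sub_zero (∫ x, f (Φ x) * F x ∂Q), ← hzero g hg, ← integral_sub (hint f) (hint g),
      ← integral_const_mul]
    refine norm_integral_le_of_norm_le (hFint.norm.const_mul ε) ?_
    filter_upwards [hQ] with x hx
    rw [← sub_mul, norm_mul]
    gcongr
    exact (hfg _ hx).le
  have hlim : Filter.Tendsto (fun ε : ℝ => ε * ∫ x, ‖F x‖ ∂Q) (nhdsWithin 0 (Set.Ioi 0))
      (nhds 0) := by
    have : Continuous fun ε : ℝ => ε * ∫ x, ‖F x‖ ∂Q := by fun_prop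
    simpa using (this.tendsto 0).mono_left nhdsWithin_le_nhds
  exact norm_le_zero_iff.mp <| ge_of_tendsto hlim <|
    Filter.eventually_of_mem self_mem_nhdsWithin hbound

theorem setIntegral_preimage_eq_zero_of_separatesPoints (hΦ : Measurable Φ) (hK : IsCompact K)
    (hQ : ∀ᵐ x ∂Q, Φ x ∈ K) (hF : Measurable F) (hFC : ∀ᵐ x ∂Q, ‖F x‖ ≤ C) (hC : 0 ≤ C)
    (hA : A.SeparatesPoints) (hzero : ∀ g ∈ A, ∫ x, g (Φ x) * F x ∂Q = 0)
    {E : Set X} (hE : MeasurableSet E) : ∫ x in Φ ⁻¹' E, F x ∂Q = 0 := by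
  have hFint : Integrable F Q := Integrable.of_bound hF.aestronglyMeasurable C hFC
  have hbound (ε : ℝ) (hε : 0 < ε) : ‖∫ x in Φ ⁻¹' E, F x ∂Q‖ ≤ C * ε := by
    have hind : Integrable (E.indicator fun _ => (1 : ℂ)) (Q.map Φ) :=
      (integrable_const 1).indicator hE
    obtain ⟨g, hg, hgint⟩ := hind.exists_boundedContinuous_integral_sub_le hε
    have hgF : Integrable (fun x => g (Φ x) * F x) Q :=
      hFint.bdd_mul (g.continuous.measurable.comp hΦ).aestronglyMeasurable (c := ‖g‖)
        (.of_forall fun x => g.norm_coe_le_norm _)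
    have hsub : ∫ x in Φ ⁻¹' E, F x ∂Q =
        ∫ x, ((Φ ⁻¹' E).indicator F x - g (Φ x) * F x) ∂Q := by
      have h0 : ∫ x, g (Φ x) * F x ∂Q = 0 :=
        integral_comp_mul_eq_zero_of_separatesPoints hΦ hK hQ hF hFC hA hzero g.toContinuousMap
      rw [integral_sub (hFint.indicator (hΦ hE)) hgF, integral_indicator (hΦ hE), h0, sub_zero]
    have hdiff : Integrable (fun x => ‖E.indicator (fun _ => (1 : ℂ)) x - g x‖) (Q.map Φ) :=
      (hind.sub hgint).norm
    rw [integral_map hΦ.aemeasurable hdiff.aestronglyMeasurable] at hg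
    rw [hsub]
    refine le_trans ?_ (mul_le_mul_of_nonneg_left hg hC)
    rw [← integral_const_mul]
    refine norm_integral_le_of_norm_le ((hdiff.comp_measurable hΦ).const_mul C) ?_
    filter_upwards [hFC] with x hx
    have : (Φ ⁻¹' E).indicator F x - g (Φ x) * F x =
        F x * (E.indicator (fun _ => (1 : ℂ)) (Φ x) - g (Φ x)) := by
      by_cases h : Φ x ∈ E <;> simp [h] <;> ring
    rw [this, norm_mul]
    gcongr
  have hlim : Filter.Tendsto (fun ε : ℝ => C * ε) (nhdsWithin 0 (Set.Ioi 0)) (nhds 0) := by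
    have : Continuous fun ε : ℝ => C * ε := by fun_prop
    simpa using (this.tendsto 0).mono_left nhdsWithin_le_nhds
  exact norm_le_zero_iff.mp <| ge_of_tendsto hlim <|
    Filter.eventually_of_mem self_mem_nhdsWithin hbound

end Uniqueness

section ElementarySymmetric

/-- The elementary symmetric functions of two complex variables. -/
def sumProd (x : ℂ × ℂ) : ℂ × ℂ := (x.1 + x.2, x.1 * x.2)

theorem continuous_sumProd : Continuous sumProd := by
  unfold sumProd; fun_prop

theorem sumProd_swap (x : ℂ × ℂ) : sumProd x.swap = sumProd x := by
  simp [sumProd, add_comm, mul_comm]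

theorem eq_or_eq_swap_of_sumProd_eq {x y : ℂ × ℂ} (h : sumProd x = sumProd y) :
    x = y ∨ x = y.swap := by
  obtain ⟨z, w⟩ := x
  obtain ⟨u, v⟩ := y
  simp only [sumProd, Prod.mk.injEq, Prod.swap_prod_mk] at h ⊢
  obtain ⟨hs, hp⟩ := h
  have : (z - u) * (z - v) = 0 := by linear_combination z * hs - hp
  rcases mul_eq_zero.mp this with hz | hz
  · exact Or.inl ⟨by linear_combination hz, by linear_combination hs - hz⟩
  · exact Or.inr ⟨by linear_combination hz, by linear_combination hs - hz⟩

/-- The pairs whose first component is lexicographically smaller than the second one. -/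
def lexLT : Set (ℂ × ℂ) :=
  {x | x.1.re < x.2.re ∨ (x.1.re = x.2.re ∧ x.1.im < x.2.im)}

theorem measurableSet_lexLT : MeasurableSet lexLT := by
  have h₁ : Measurable fun x : ℂ × ℂ => x.1.re := by fun_prop
  have h₂ : Measurable fun x : ℂ × ℂ => x.2.re := by fun_prop
  have h₃ : Measurable fun x : ℂ × ℂ => x.1.im := by fun_prop
  have h₄ : Measurable fun x : ℂ × ℂ => x.2.im := by fun_prop
  exact (measurableSet_lt h₁ h₂).union
    ((measurableSet_eq_fun h₁ h₂).inter (measurableSet_lt h₃ h₄))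

theorem swap_notMem_lexLT {x : ℂ × ℂ} (hx : x ∈ lexLT) : x.swap ∉ lexLT := by
  simp only [lexLT, Set.mem_ofPred_eq, Prod.fst_swap, Prod.snd_swap] at hx ⊢
  grind

theorem mem_lexLT_or_swap_mem {x : ℂ × ℂ} (hx : x.1 ≠ x.2) : x ∈ lexLT ∨ x.swap ∈ lexLT := by
  simp only [lexLT, Set.mem_ofPred_eq, Prod.fst_swap, Prod.snd_swap]
  rw [Ne, Complex.ext_iff] at hx
  grind

theorem injOn_sumProd_lexLT : Set.InjOn sumProd lexLT := by
  intro x hx y hy hxy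
  rcases eq_or_eq_swap_of_sumProd_eq hxy with h | h
  · exact h
  · exact absurd (h ▸ hx) (swap_notMem_lexLT hy)

theorem preimage_sumProd_image (A : Set (ℂ × ℂ)) :
    sumProd ⁻¹' (sumProd '' A) = A ∪ Prod.swap ⁻¹' A := by
  ext x
  constructor
  · rintro ⟨y, hy, hyx⟩
    rcases eq_or_eq_swap_of_sumProd_eq hyx with rfl | rfl
    · exact Or.inl hy
    · exact Or.inr hy
  · rintro (hx | hx)
    · exact ⟨x, hx, rfl⟩
    · exact ⟨x.swap, hx, sumProd_swap x⟩

/-- A swap-invariant density all of whose integrals over preimages under `sumProd` vanish is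
almost everywhere zero off the diagonal. -/
theorem ae_eq_zero_of_setIntegral_preimage_sumProd {P : Measure ℂ} [IsFiniteMeasure P]
    {F : ℂ × ℂ → ℂ} (hF : Integrable F (P.prod P)) (hswap : ∀ x, F x.swap = F x)
    (hzero : ∀ E, MeasurableSet E → ∫ x in sumProd ⁻¹' E, F x ∂(P.prod P) = 0) :
    ∀ᵐ x ∂(P.prod P), x.1 ≠ x.2 → F x = 0 := by
  have hset (A : Set (ℂ × ℂ)) (hA : MeasurableSet A) (hAl : A ⊆ lexLT) :
      ∫ x in A, F x ∂(P.prod P) = 0 := by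
    have hE := hzero _ (hA.image_of_continuousOn_injOn continuous_sumProd.continuousOn
      (injOn_sumProd_lexLT.mono hAl))
    have hdisj : Disjoint A (Prod.swap ⁻¹' A) :=
      Set.disjoint_left.mpr fun x hx hx' => swap_notMem_lexLT (hAl hx) (hAl hx')
    rw [preimage_sumProd_image, setIntegral_union hdisj (measurable_swap hA) hF.integrableOn
      hF.integrableOn] at hE
    have hsymm : ∫ x in Prod.swap ⁻¹' A, F x ∂(P.prod P) = ∫ x in A, F x ∂(P.prod P) := by
      have := Measure.measurePreserving_swap.setIntegral_preimage_emb
        (μ := P.prod P) (ν := P.prod P) MeasurableEquiv.prodComm.measurableEmbedding F A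
      rw [← this]
      simp only [hswap]
    rw [hsymm] at hE
    linear_combination hE / 2
  have hlex : ∀ᵐ x ∂(P.prod P), x ∈ lexLT → F x = 0 := by
    have h0 := (hF.indicator measurableSet_lexLT).ae_eq_zero_of_forall_setIntegral_eq_zero
      fun s hs _ => by
        rw [setIntegral_indicator measurableSet_lexLT]
        exact hset _ (hs.inter measurableSet_lexLT) Set.inter_subset_right
    filter_upwards [h0] with x hx hxl
    simpa [hxl] using hx
  have hlex' : ∀ᵐ x ∂(P.prod P), x.swap ∈ lexLT → F x.swap = 0 :=
    Measure.measurePreserving_swap.quasiMeasurePreserving.ae hlex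
  filter_upwards [hlex, hlex'] with x h1 h2 hne
  rcases mem_lexLT_or_swap_mem hne with h | h
  · exact h1 h
  · rw [← hswap, h2 h]

end ElementarySymmetric

section Polynomials

/-- The algebra of holomorphic polynomials in two complex variables. -/
noncomputable def holPoly : Subalgebra ℂ C(ℂ × ℂ, ℂ) :=
  Algebra.adjoin ℂ {ContinuousMap.fst, ContinuousMap.snd}

theorem fst_mem_holPoly : ContinuousMap.fst ∈ holPoly :=
  Algebra.subset_adjoin (by simp)

theorem snd_mem_holPoly : ContinuousMap.snd ∈ holPoly :=
  Algebra.subset_adjoin (by simp)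

theorem holPoly_induction {p : C(ℂ × ℂ, ℂ) → Prop}
    (monomial : ∀ a b : ℕ, p (ContinuousMap.fst ^ a * ContinuousMap.snd ^ b)) (zero : p 0)
    (add : ∀ f g, p f → p g → p (f + g)) (smul : ∀ (c : ℂ) f, p f → p (c • f))
    {f : C(ℂ × ℂ, ℂ)} (hf : f ∈ holPoly) : p f := by
  rw [holPoly, ← Subalgebra.mem_toSubmodule, Algebra.adjoin_eq_span] at hf
  induction hf using Submodule.span_induction with
  | mem x hx =>
    obtain ⟨a, b, rfl⟩ := (Submonoid.mem_closure_pair _ _ _).mp hx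
    exact monomial a b
  | zero => exact zero
  | add f g _ _ hf hg => exact add f g hf hg
  | smul c f _ hf => exact smul c f hf

theorem comp_sumProd_mem_holPoly {f : C(ℂ × ℂ, ℂ)} (hf : f ∈ holPoly) :
    f.comp ⟨sumProd, continuous_sumProd⟩ ∈ holPoly := by
  refine holPoly_induction (p := fun f => f.comp ⟨sumProd, continuous_sumProd⟩ ∈ holPoly)
    (fun a b => ?_) (zero_mem holPoly) (fun f g hf hg => add_mem hf hg)
    (fun c f hf => holPoly.smul_mem hf c) hf
  exact mul_mem (pow_mem (add_mem fst_mem_holPoly snd_mem_holPoly) a)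
    (pow_mem (mul_mem fst_mem_holPoly snd_mem_holPoly) b)

/-- The star algebra of polynomials in two complex variables and their conjugates. -/
noncomputable def starPoly : StarSubalgebra ℂ C(ℂ × ℂ, ℂ) :=
  StarAlgebra.adjoin ℂ {ContinuousMap.fst, ContinuousMap.snd}

theorem separatesPoints_starPoly : starPoly.SeparatesPoints := by
  intro x y hxy
  by_cases h : x.1 = y.1
  · exact ⟨_, ⟨ContinuousMap.snd, StarAlgebra.subset_adjoin ℂ _ (by simp), rfl⟩,
      fun h' => hxy (Prod.ext h h')⟩
  · exact ⟨_, ⟨ContinuousMap.fst, StarAlgebra.subset_adjoin ℂ _ (by simp), rfl⟩, h⟩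

theorem starPoly_induction {p : C(ℂ × ℂ, ℂ) → Prop}
    (mul_star : ∀ f ∈ holPoly, ∀ g ∈ holPoly, p (f * star g))
    (add : ∀ f g, p f → p g → p (f + g)) {f : C(ℂ × ℂ, ℂ)} (hf : f ∈ starPoly) : p f := by
  rw [starPoly, ← StarSubalgebra.mem_toSubalgebra, StarAlgebra.adjoin_toSubalgebra,
    ← Subalgebra.mem_toSubmodule, Algebra.adjoin_union_coe_submodule,
    ← Subalgebra.star_adjoin_comm] at hf
  induction hf using Submodule.mul_induction_on' with
  | mem_mul_mem f hf g hg =>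
    rw [← star_star g]
    exact mul_star f hf _ hg
  | add f _ g _ hf hg => exact add f g hf hg

end Polynomials

section Moments

theorem ae_prod_mem_prod {P : Measure ℂ} {K : Set ℂ} (hPK : ∀ᵐ z ∂P, z ∈ K) :
    ∀ᵐ x ∂(P.prod P), x ∈ K ×ˢ K := by
  filter_upwards [Measure.quasiMeasurePreserving_fst.ae hPK,
    Measure.quasiMeasurePreserving_snd.ae hPK] with x h1 h2 using ⟨h1, h2⟩

variable {P : Measure ℂ} [IsFiniteMeasure P] {h : ℂ → ℂ} {K : Set ℂ}

/-- If the moments of `h • P` have rank one, the sesquilinear form of `h • P ⊗ h • P` on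
polynomials is unchanged when the two variables are swapped in one argument. -/
theorem integral_mul_star_swap (hmeas : Measurable h) (hnorm : ∀ z, ‖h z‖ = 1)
    (hK : IsCompact K) (hPK : ∀ᵐ z ∂P, z ∈ K) (hmass : ∫ z, h z ∂P ≠ 0)
    (hcov : ∀ m n : ℕ,
      (∫ z, h z ∂P) * ∫ z, z ^ n * (starRingEnd ℂ) z ^ m * h z ∂P
        = (∫ z, z ^ n * h z ∂P) * ∫ z, (starRingEnd ℂ) z ^ m * h z ∂P)
    {f g : C(ℂ × ℂ, ℂ)} (hf : f ∈ holPoly) (hg : g ∈ holPoly) :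
    ∫ x, f x * star (g x) * (h x.1 * h x.2) ∂(P.prod P) =
      ∫ x, f x * star (g x.swap) * (h x.1 * h x.2) ∂(P.prod P) := by
  have hint (u : ℂ × ℂ → ℂ) (hu : Continuous u) :
      Integrable (fun x => u x * (h x.1 * h x.2)) (P.prod P) :=
    integrable_mul_of_ae_mem_isCompact (hK.prod hK) (ae_prod_mem_prod hPK) hu (by fun_prop)
      (by simp [hnorm])
  have hmon (a b c d : ℕ) :
      ∫ x : ℂ × ℂ, x.1 ^ a * x.2 ^ b * star (x.1 ^ c * x.2 ^ d) * (h x.1 * h x.2) ∂(P.prod P) =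
        (∫ z, z ^ a * (starRingEnd ℂ) z ^ c * h z ∂P) *
          ∫ z, z ^ b * (starRingEnd ℂ) z ^ d * h z ∂P := by
    rw [← integral_prod_mul]
    congr 1 with x
    simp only [star_mul', star_pow, starRingEnd_apply]
    ring
  refine holPoly_induction (p := fun f => ∫ x, f x * star (g x) * (h x.1 * h x.2) ∂(P.prod P) =
      ∫ x, f x * star (g x.swap) * (h x.1 * h x.2) ∂(P.prod P)) (fun a b => ?_) (by simp)
    (fun f₁ f₂ h₁ h₂ => ?_) (fun c f hf => ?_) hf
  · refine holPoly_induction (p := fun g => ∫ x, (ContinuousMap.fst ^ a * ContinuousMap.snd ^ b :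
        C(ℂ × ℂ, ℂ)) x * star (g x) * (h x.1 * h x.2) ∂(P.prod P) =
      ∫ x, (ContinuousMap.fst ^ a * ContinuousMap.snd ^ b : C(ℂ × ℂ, ℂ)) x *
        star (g x.swap) * (h x.1 * h x.2) ∂(P.prod P)) (fun c d => ?_) (by simp)
      (fun g₁ g₂ h₁ h₂ => ?_) (fun c g hg => ?_) hg
    · have e₁ := hmon a b c d
      have e₂ := hmon a b d c
      simp only [ContinuousMap.mul_apply, ContinuousMap.pow_apply, ContinuousMap.fst_apply,
        ContinuousMap.snd_apply, Prod.fst_swap, Prod.snd_swap]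
      simp only [mul_comm (_ ^ d)] at e₂
      rw [e₁, e₂]
      apply mul_left_cancel₀ (mul_ne_zero hmass hmass)
      rw [mul_mul_mul_comm, hcov, hcov, mul_mul_mul_comm (∫ z, h z ∂P), hcov, hcov]
      ring
    · simp only [ContinuousMap.add_apply, star_add, mul_add, add_mul]
      rw [integral_add (hint _ (by fun_prop)) (hint _ (by fun_prop)),
        integral_add (hint _ (by fun_prop)) (hint _ (by fun_prop)), h₁, h₂]
    · simp only [ContinuousMap.smul_apply, smul_eq_mul, star_mul', mul_left_comm _ (star c),
        mul_assoc (star c), integral_const_mul] at hg ⊢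
      rw [hg]
  · simp only [ContinuousMap.add_apply, add_mul]
    rw [integral_add (hint _ (by fun_prop)) (hint _ (by fun_prop)),
      integral_add (hint _ (by fun_prop)) (hint _ (by fun_prop)), h₁, h₂]
  · simp only [ContinuousMap.smul_apply, smul_eq_mul, mul_assoc c, integral_const_mul] at hf ⊢
    rw [hf]

/-- If the moments of `h • P` have rank one, then `P ⊗ P` is carried by the diagonal. -/
theorem ae_fst_eq_snd_of_moments (hmeas : Measurable h) (hnorm : ∀ z, ‖h z‖ = 1)
    (hK : IsCompact K) (hPK : ∀ᵐ z ∂P, z ∈ K) (hmass : ∫ z, h z ∂P ≠ 0)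
    (hcov : ∀ m n : ℕ,
      (∫ z, h z ∂P) * ∫ z, z ^ n * (starRingEnd ℂ) z ^ m * h z ∂P
        = (∫ z, z ^ n * h z ∂P) * ∫ z, (starRingEnd ℂ) z ^ m * h z ∂P) :
    ∀ᵐ x ∂(P.prod P), x.1 = x.2 := by
  have hQ := ae_prod_mem_prod hPK
  have hint (u : ℂ × ℂ → ℂ) (hu : Continuous u) :
      Integrable (fun x => u x * (h x.1 * h x.2)) (P.prod P) :=
    integrable_mul_of_ae_mem_isCompact (hK.prod hK) hQ hu (by fun_prop) (by simp [hnorm])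
  let Δ : C(ℂ × ℂ, ℂ) := ContinuousMap.fst - ContinuousMap.snd
  have hΔ : Δ ∈ holPoly := sub_mem fst_mem_holPoly snd_mem_holPoly
  have hΔs (x : ℂ × ℂ) : Δ x.swap = -Δ x := by simp [Δ]
  let F : ℂ × ℂ → ℂ := fun x => Δ x * star (Δ x) * (h x.1 * h x.2)
  have hFswap (x : ℂ × ℂ) : F x.swap = F x := by
    simp only [F, hΔs, Prod.fst_swap, Prod.snd_swap, star_neg]
    ring
  have hΔc : Continuous fun x => Δ x * star (Δ x) := by fun_prop
  have hzero : ∀ g ∈ starPoly, ∫ x, g (sumProd x) * F x ∂(P.prod P) = 0 := by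
    intro g hg
    refine starPoly_induction (p := fun g => ∫ x, g (sumProd x) * F x ∂(P.prod P) = 0)
      (fun f hf g hg => ?_) (fun f g hf hg => ?_) hg
    · have hswap := integral_mul_star_swap hmeas hnorm hK hPK hmass hcov
        (mul_mem (comp_sumProd_mem_holPoly hf) hΔ) (mul_mem (comp_sumProd_mem_holPoly hg) hΔ)
      simp only [ContinuousMap.mul_apply, ContinuousMap.comp_apply, ContinuousMap.coe_mk,
        sumProd_swap, hΔs, mul_neg, star_neg, neg_mul, integral_neg] at hswap
      have heq : ∀ x, (f * star g) (sumProd x) * F x =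
          f (sumProd x) * Δ x * star (g (sumProd x) * Δ x) * (h x.1 * h x.2) := fun x => by
        simp only [F, ContinuousMap.mul_apply, ContinuousMap.star_apply, star_mul']
        ring
      simp only [heq]
      linear_combination hswap / 2
    · have hi (u : C(ℂ × ℂ, ℂ)) : Integrable (fun x => u (sumProd x) * F x) (P.prod P) := by
        simp only [F, ← mul_assoc (u _)]
        have := continuous_sumProd
        exact hint _ (by fun_prop)
      simp only [ContinuousMap.add_apply, add_mul]
      rw [integral_add (hi f) (hi g), hf, hg, add_zero]
  obtain ⟨C, hC⟩ := (hK.prod hK).exists_bound_of_continuousOn hΔc.continuousOn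
  have hFC : ∀ᵐ x ∂(P.prod P), ‖F x‖ ≤ |C| := by
    filter_upwards [hQ] with x hx
    simp only [F, norm_mul (Δ x * _), norm_mul (h _), hnorm, mul_one]
    exact (hC x hx).trans (le_abs_self C)
  have hFzero := ae_eq_zero_of_setIntegral_preimage_sumProd (hint _ hΔc) hFswap fun E hE =>
    setIntegral_preimage_eq_zero_of_separatesPoints continuous_sumProd.measurable
      ((hK.prod hK).image continuous_sumProd) (hQ.mono fun x hx => ⟨x, hx, rfl⟩)
      (hΔc.measurable.mul (by fun_prop)) hFC (abs_nonneg C) separatesPoints_starPoly hzero hE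
  have hne (z : ℂ) : h z ≠ 0 := fun h0 => by simpa [h0] using hnorm z
  filter_upwards [hFzero] with x hx
  by_contra hx'
  simpa [hne, Δ, sub_eq_zero, hx', ← map_sub] using hx hx'

end Moments

/-- A compactly supported complex Borel measure on ℂ (encoded via its polar
decomposition `h • P`) with nonzero total mass satisfying the covariance
equation equals `μ(ℂ) · δ_ζ` with `ζ = (∫ z dμ)/μ(ℂ)`. -/
theorem stmt_1 (P : Measure ℂ) [IsFiniteMeasure P] (h : ℂ → ℂ)
    (hmeas : Measurable h) (hnorm : ∀ z, ‖h z‖ = 1)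
    (hsupp : ∃ K : Set ℂ, IsCompact K ∧ P Kᶜ = 0)
    (hmass : ∫ z, h z ∂P ≠ 0)
    (hcov : ∀ m n : ℕ,
      (∫ z, h z ∂P) * ∫ z, z ^ n * (starRingEnd ℂ) z ^ m * h z ∂P
        = (∫ z, z ^ n * h z ∂P) * ∫ z, (starRingEnd ℂ) z ^ m * h z ∂P) :
    ∀ s : Set ℂ, MeasurableSet s →
      ∫ z in s, h z ∂P =
        if (∫ z, z * h z ∂P) / (∫ z, h z ∂P) ∈ s then ∫ z, h z ∂P else 0 := by
  obtain ⟨K, hK, hPK⟩ := hsupp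
  have hdiag := Measure.ae_ae_of_ae_prod
    (ae_fst_eq_snd_of_moments hmeas hnorm hK (ae_iff.mpr hPK) hmass hcov)
  have hP : P ≠ 0 := by
    rintro rfl
    simp at hmass
  have : (ae P).NeBot := ae_neBot.mpr hP
  obtain ⟨ζ, hζ⟩ := hdiag.exists
  have hmean : (∫ z, z * h z ∂P) / (∫ z, h z ∂P) = ζ := by
    rw [div_eq_iff hmass, ← integral_const_mul]
    refine integral_congr_ae ?_
    filter_upwards [hζ] with z hz
    rw [← hz]
  intro s hs
  rw [hmean, ← integral_indicator hs]
  split_ifs with hmem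
  · refine integral_congr_ae ?_
    filter_upwards [hζ] with z hz
    simp [← hz, hmem]
  · refine integral_eq_zero_of_ae ?_
    filter_upwards [hζ] with z hz
    simp [← hz, hmem]
end

section
/- Let Γ be a compact Hausdorff space, μ a complex regular Borel measure on Γ, F : Γ → ℂ continuous, and suppose μ satisfies the covariance equation with respect to F in the form: for a family of continuous multiplicative evaluation functions. Specialized to Γ ⊂ ℂ compact: if μ(Γ) ≠ 0, F·μ ≠ 0, and μ(Γ)·∫ zⁿ conj(z)ᵐ |F|² dμ = (∫ zⁿ F dμ)(∫ conj(z)ᵐ conj(F) dμ) for all m, n ∈ ℕ, then ∫ |F|² dμ ≠ 0, ∫ F dμ ≠ 0, and ∫ conj(F) dμ ≠ 0. -/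
open MeasureTheory Complex

/-- A continuous function is bounded on a bounded set, so multiplication by it preserves
integrability with respect to a boundedly supported measure. -/
theorem integrable_continuous_mul {P : Measure ℂ} {R : ℝ} (hR : ∀ᵐ z ∂P, ‖z‖ ≤ R)
    {φ G : ℂ → ℂ} (hφ : Continuous φ) (hG : Integrable G P) :
    Integrable (fun z => φ z * G z) P := by
  obtain ⟨C, hC⟩ := (isCompact_closedBall (0 : ℂ) R).exists_bound_of_continuousOn hφ.continuousOn
  refine hG.bdd_mul (c := C) hφ.aestronglyMeasurable ?_
  filter_upwards [hR] with z hz using hC z (by simpa using hz)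

/-- The exponential transform of an integrable density is the sum of its moment series. -/
theorem hasSum_integral_exp_mul {P : Measure ℂ} {R : ℝ} (hR : ∀ᵐ z ∂P, ‖z‖ ≤ R)
    {u G : ℂ → ℂ} (hu : Continuous u) (hun : ∀ z, ‖u z‖ = ‖z‖) (hG : Integrable G P) (ζ : ℂ) :
    HasSum (fun n : ℕ => ζ ^ n / (n.factorial : ℂ) * ∫ z, u z ^ n * G z ∂P)
      (∫ z, cexp (ζ * u z) * G z ∂P) := by
  have hint (n : ℕ) : Integrable (fun z => ζ ^ n / (n.factorial : ℂ) * (u z ^ n * G z)) P :=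
    (integrable_continuous_mul hR (hu.pow n) hG).const_mul _
  have hsummable : Summable fun n : ℕ =>
      ∫ z, ‖ζ ^ n / (n.factorial : ℂ) * (u z ^ n * G z)‖ ∂P := by
    refine Summable.of_nonneg_of_le (fun n => integral_nonneg fun z => norm_nonneg _) (fun n => ?_)
      ((Real.summable_pow_div_factorial (‖ζ‖ * R)).mul_right (∫ z, ‖G z‖ ∂P))
    rw [← integral_const_mul]
    refine integral_mono_ae (hint n).norm (hG.norm.const_mul _) ?_
    filter_upwards [hR] with z hz
    have : ‖ζ ^ n / (n.factorial : ℂ) * (u z ^ n * G z)‖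
        = (‖ζ‖ * ‖z‖) ^ n / n.factorial * ‖G z‖ := by
      simp only [norm_mul, norm_div, norm_pow, hun, Complex.norm_natCast]
      ring
    rw [this]
    gcongr
  have key := hasSum_integral_of_summable_integral_norm hint hsummable
  simp_rw [integral_const_mul] at key
  convert! key using 1
  refine integral_congr_ae (.of_forall fun z => ?_)
  have hexp := (NormedSpace.expSeries_div_hasSum_exp (ζ * u z)).mul_right (G z)
  rw [← Complex.exp_eq_exp_ℂ] at hexp
  dsimp only
  rw [← hexp.tsum_eq]
  refine tsum_congr fun n => ?_
  ring

theorem hasDerivAt_integral_exp_mul {P : Measure ℂ} {R : ℝ} (hR : ∀ᵐ z ∂P, ‖z‖ ≤ R)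
    {G : ℂ → ℂ} (hG : Integrable G P) (ζ₀ : ℂ) :
    HasDerivAt (fun ζ => ∫ z, cexp (ζ * z) * G z ∂P)
      (∫ z, cexp (ζ₀ * z) * (z * G z) ∂P) ζ₀ := by
  have hzG := integrable_continuous_mul hR continuous_id hG
  have hint (ζ : ℂ) {H : ℂ → ℂ} (hH : Integrable H P) :
      Integrable (fun z => cexp (ζ * z) * H z) P :=
    integrable_continuous_mul hR (by fun_prop) hH
  refine (hasDerivAt_integral_of_dominated_loc_of_deriv_le
    (F := fun ζ z => cexp (ζ * z) * G z) (F' := fun ζ z => cexp (ζ * z) * (z * G z))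
    (bound := fun z => Real.exp ((‖ζ₀‖ + 1) * R) * ‖z * G z‖)
    (Metric.ball_mem_nhds ζ₀ one_pos) (.of_forall fun ζ => (hint ζ hG).aestronglyMeasurable)
    (hint ζ₀ hG) (hint ζ₀ hzG).aestronglyMeasurable ?_ (hzG.norm.const_mul _) ?_).2
  · filter_upwards [hR] with z hz ζ hζ
    rw [norm_mul]
    gcongr
    refine (norm_exp_le_exp_norm _).trans (Real.exp_le_exp.2 ?_)
    rw [norm_mul]
    have : ‖ζ‖ ≤ ‖ζ₀‖ + 1 := by
      have h1 := norm_le_norm_add_norm_sub' ζ ζ₀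
      rw [Metric.mem_ball, dist_eq_norm] at hζ
      linarith
    gcongr
  · refine .of_forall fun z ζ _ => ?_
    have h1 := (((hasDerivAt_id ζ).mul_const z).cexp).mul_const (G z)
    convert! h1 using 1
    simp only [id]
    ring

/-- A density whose exponential transform vanishes identically has vanishing moments. -/
theorem integral_pow_mul_eq_zero {P : Measure ℂ} {R : ℝ} (hR : ∀ᵐ z ∂P, ‖z‖ ≤ R)
    {G : ℂ → ℂ} (hG : Integrable G P) (h0 : ∀ ζ, ∫ z, cexp (ζ * z) * G z ∂P = 0) (n : ℕ) :
    ∫ z, z ^ n * G z ∂P = 0 := by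
  suffices ∀ ζ, ∫ z, cexp (ζ * z) * (z ^ n * G z) ∂P = 0 by simpa using this 0
  induction n with
  | zero => simpa using h0
  | succ n ih =>
    intro ζ
    have h1 := hasDerivAt_integral_exp_mul hR
      (integrable_continuous_mul hR (continuous_pow n) hG) ζ
    rw [funext ih] at h1
    rw [(hasDerivAt_const ζ (0 : ℂ)).unique h1]
    simp only [pow_succ']
    simp only [mul_assoc]

/-- An integrable density on a bounded set all of whose mixed moments vanish is zero. -/
theorem ae_eq_zero_of_moments_eq_zero {P : Measure ℂ} {R : ℝ} (hR : ∀ᵐ z ∂P, ‖z‖ ≤ R)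
    {K : ℂ → ℂ} (hK : Integrable K P)
    (h0 : ∀ m n : ℕ, ∫ z, z ^ n * (starRingEnd ℂ) z ^ m * K z ∂P = 0) :
    ∀ᵐ z ∂P, K z = 0 := by
  set s : Set ℂ := Metric.closedBall 0 R
  have hs : MeasurableSet s := Metric.isClosed_closedBall.measurableSet
  have : CompactSpace s := isCompact_iff_compactSpace.1 (isCompact_closedBall _ _)
  have hrestrict : P.restrict s = P :=
    Measure.restrict_eq_self_of_ae_mem (by filter_upwards [hR] with z hz; simpa [s] using hz)
  set Q : Measure s := P.comap Subtype.val
  have hQ (f : ℂ → ℂ) : ∫ x : s, f x ∂Q = ∫ z, f z ∂P := by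
    rw [integral_subtype_comap hs, hrestrict]
  have hKQ : Integrable (fun x : s => K x) Q := by
    have := (MeasurableEmbedding.subtype_coe hs).integrableOn_range_iff_comap (f := K) (μ := P)
    rw [Subtype.range_coe, IntegrableOn, hrestrict] at this
    exact this.1 hK
  have hbdd (f : C(s, ℂ)) : Integrable (fun x => f x * K x) Q :=
    hKQ.bdd_mul (c := ‖f‖) f.continuous.aestronglyMeasurable (.of_forall f.norm_coe_le_norm)
  let L : C(s, ℂ) →L[ℂ] ℂ := LinearMap.mkContinuous
    { toFun := fun f => ∫ x, f x * K x ∂Q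
      map_add' := fun f g => by
        simp only [ContinuousMap.add_apply, add_mul]
        exact integral_add (hbdd f) (hbdd g)
      map_smul' := fun a f => by
        simp only [ContinuousMap.smul_apply, smul_eq_mul, mul_assoc, integral_const_mul,
          RingHom.id_apply] }
    (∫ x, ‖K x‖ ∂Q) (fun f => by
      rw [mul_comm, ← integral_const_mul]
      refine norm_integral_le_of_norm_le (hKQ.norm.const_mul _) (.of_forall fun x => ?_)
      rw [norm_mul]
      gcongr
      exact f.norm_coe_le_norm x)
  have hL (f : C(s, ℂ)) : L f = ∫ x, f x * K x ∂Q := rfl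
  let X : C(s, ℂ) := Polynomial.toContinuousMapOnAlgHom s Polynomial.X
  have hX (x : s) : X x = x := by simp [X]
  let V (g : C(s, ℂ)) : Prop := ∀ m n : ℕ, L (X ^ n * star X ^ m * g) = 0
  have hV1 : V 1 := fun m n => by
    rw [hL, ← h0 m n, ← hQ]
    simp [hX]
  have hVX {g : C(s, ℂ)} (hg : V g) : V (X * g) := fun m n => by
    rw [← hg m (n + 1)]
    congr 1
    ring
  have hVX' {g : C(s, ℂ)} (hg : V g) : V (star X * g) := fun m n => by
    rw [← hg (m + 1) n]
    congr 1
    ring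
  have hVsmul (r : ℂ) {g : C(s, ℂ)} (hg : V g) : V (r • g) := fun m n => by
    rw [mul_smul_comm, map_smul, hg m n, smul_zero]
  have hVadd {f g : C(s, ℂ)} (hf : V f) (hg : V g) : V (f + g) := fun m n => by
    rw [mul_add, map_add, hf m n, hg m n, add_zero]
  have hmem : ∀ f ∈ (polynomialFunctions s).starClosure,
      (∀ g, V g → V (f * g)) ∧ ∀ g, V g → V (star f * g) := by
    rw [polynomialFunctions.starClosure_eq_adjoin_X]
    intro f hf
    induction hf using StarAlgebra.adjoin_induction with
    | mem f hf =>
      rw [Set.mem_singleton_iff] at hf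
      subst hf
      exact ⟨fun g hg => hVX hg, fun g hg => hVX' hg⟩
    | algebraMap r =>
      refine ⟨fun g hg => ?_, fun g hg => ?_⟩
      · rw [← Algebra.smul_def]
        exact hVsmul r hg
      · rw [← algebraMap_star_comm, ← Algebra.smul_def]
        exact hVsmul _ hg
    | add f₁ f₂ _ _ h₁ h₂ =>
      refine ⟨fun g hg => ?_, fun g hg => ?_⟩
      · rw [add_mul]
        exact hVadd (h₁.1 g hg) (h₂.1 g hg)
      · rw [star_add, add_mul]
        exact hVadd (h₁.2 g hg) (h₂.2 g hg)
    | mul f₁ f₂ _ _ h₁ h₂ =>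
      refine ⟨fun g hg => ?_, fun g hg => ?_⟩
      · rw [mul_assoc]
        exact h₁.1 _ (h₂.1 g hg)
      · rw [star_mul, mul_assoc]
        exact h₂.2 _ (h₁.2 g hg)
    | star f _ hf => exact ⟨hf.2, by simpa using hf.1⟩
  have hzero (f : C(s, ℂ)) : L f = 0 := by
    have hf : f ∈ (polynomialFunctions s).starClosure.topologicalClosure := by
      rw [polynomialFunctions.starClosure_topologicalClosure]
      trivial
    have hcl : IsClosed {f | L f = 0} := isClosed_eq L.continuous continuous_const
    refine hcl.closure_subset_iff.2 (fun g hg => ?_) hf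
    simpa using (hmem g hg).1 1 hV1 0 0
  refine ae_eq_zero_of_integral_contDiff_smul_eq_zero hK.locallyIntegrable fun g hg _ => ?_
  have := hzero ⟨fun x => (g x : ℂ), by
    have := hg.continuous
    fun_prop⟩
  rw [hL] at this
  rw [← this, ← hQ]
  simp

/-- If the mixed moments of a density factor and its total mass is zero, the density is zero:
by Liouville's theorem, the product of the exponential transforms of the factors is constant. -/
theorem ae_eq_zero_of_moments_factor {P : Measure ℂ} {R : ℝ} (hR : ∀ᵐ z ∂P, ‖z‖ ≤ R)
    {K A B : ℂ → ℂ} (hK : Integrable K P) (hA : Integrable A P) (hB : Integrable B P)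
    {c : ℂ} (hc : c ≠ 0)
    (hcov : ∀ m n : ℕ, c * ∫ z, z ^ n * (starRingEnd ℂ) z ^ m * K z ∂P
      = (∫ z, z ^ n * A z ∂P) * ∫ z, (starRingEnd ℂ) z ^ m * B z ∂P)
    (hmass : ∫ z, K z ∂P = 0) :
    ∀ᵐ z ∂P, K z = 0 := by
  have hconj : Continuous (starRingEnd ℂ) := Complex.continuous_conj
  have hB' : Integrable (fun z => (starRingEnd ℂ) (B z)) P := by
    exact Complex.conjCLE.toContinuousLinearMap.integrable_comp hB
  have hstep (ζ : ℂ) (m : ℕ) : c * ∫ z, cexp (ζ * z) * ((starRingEnd ℂ) z ^ m * K z) ∂P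
      = (∫ z, cexp (ζ * z) * A z ∂P) * ∫ z, (starRingEnd ℂ) z ^ m * B z ∂P := by
    refine ((hasSum_integral_exp_mul hR continuous_id (fun z => rfl)
      (integrable_continuous_mul hR (hconj.pow m) hK) ζ).mul_left c).unique ?_
    convert! (hasSum_integral_exp_mul hR continuous_id (fun z => rfl) hA ζ).mul_right
      (∫ z, (starRingEnd ℂ) z ^ m * B z ∂P) using 2 with n
    simp only [id, Pi.pow_apply]
    rw [mul_assoc, ← hcov m n, mul_left_comm]
    simp only [mul_assoc]
  have hexp (ζ ξ : ℂ) : c * ∫ z, cexp (ξ * (starRingEnd ℂ) z) * (cexp (ζ * z) * K z) ∂P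
      = (∫ z, cexp (ζ * z) * A z ∂P) * ∫ z, cexp (ξ * (starRingEnd ℂ) z) * B z ∂P := by
    refine ((hasSum_integral_exp_mul hR hconj RCLike.norm_conj
      (integrable_continuous_mul hR (by fun_prop) hK) ξ).mul_left c).unique ?_
    convert! (hasSum_integral_exp_mul hR hconj RCLike.norm_conj hB ξ).mul_left
      (∫ z, cexp (ζ * z) * A z ∂P) using 2 with n
    rw [mul_left_comm, mul_left_comm _ (ξ ^ n / (n.factorial : ℂ)), ← hstep ζ n]
    simp only [mul_left_comm]
  let α (ζ : ℂ) : ℂ := ∫ z, cexp (ζ * z) * A z ∂P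
  let β (ζ : ℂ) : ℂ := ∫ z, cexp (-ζ * z) * (starRingEnd ℂ) (B z) ∂P
  have hα : Differentiable ℂ α := fun ζ => (hasDerivAt_integral_exp_mul hR hA ζ).differentiableAt
  have hβ : Differentiable ℂ β := fun ζ =>
    ((hasDerivAt_integral_exp_mul hR hB' (-ζ)).differentiableAt).comp ζ differentiable_neg.differentiableAt
  have hβconj (ζ : ℂ) : ∫ z, cexp (-(starRingEnd ℂ) ζ * (starRingEnd ℂ) z) * B z ∂P
      = (starRingEnd ℂ) (β ζ) := by
    rw [← integral_conj]
    simp [← Complex.exp_conj]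
  have hbound (ζ : ℂ) : ‖α ζ * β ζ‖ ≤ ‖c‖ * ∫ z, ‖K z‖ ∂P := by
    have h1 := congrArg norm (hexp ζ (-(starRingEnd ℂ) ζ))
    rw [hβconj, norm_mul, norm_mul, RCLike.norm_conj, ← norm_mul (∫ z, cexp (ζ * z) * A z ∂P)] at h1
    rw [← h1]
    gcongr
    refine norm_integral_le_of_norm_le hK.norm (.of_forall fun z => ?_)
    rw [← mul_assoc, ← Complex.exp_add, norm_mul, Complex.norm_exp]
    simp
  have hconst (ζ : ℂ) : α ζ * β ζ = 0 := by
    have h1 := (hα.mul hβ).apply_eq_apply_of_bounded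
      (isBounded_iff_forall_norm_le.2 ⟨_, by rintro _ ⟨ζ, rfl⟩; exact hbound ζ⟩) ζ 0
    refine h1.trans ?_
    have h2 := hcov 0 0
    have h3 := hβconj 0
    simp only [pow_zero, one_mul, hmass, mul_zero] at h2
    rw [zero_eq_mul] at h2
    rw [Pi.mul_apply, mul_eq_zero]
    refine h2.imp (fun h => by simpa [α] using h) fun h => ?_
    simpa [h] using h3.symm
  have hmom : (∀ n : ℕ, ∫ z, z ^ n * A z ∂P = 0) ∨
      ∀ m : ℕ, ∫ z, (starRingEnd ℂ) z ^ m * B z ∂P = 0 := by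
    rcases AnalyticOnNhd.eq_zero_or_eq_zero_of_mul_eq_zero
      (U := Set.univ) (hα.differentiableOn.analyticOnNhd isOpen_univ)
      (hβ.differentiableOn.analyticOnNhd isOpen_univ) (fun ζ _ => hconst ζ)
      isPreconnected_univ with h | h
    · exact .inl fun n => integral_pow_mul_eq_zero hR hA (fun ζ => h ζ trivial) n
    · refine .inr fun m => ?_
      have h1 := integral_pow_mul_eq_zero hR hB'
        (fun ζ => by simpa [β] using h (-ζ) trivial) m
      have h2 := congrArg (starRingEnd ℂ) h1
      rw [← integral_conj] at h2
      simpa using h2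
  refine ae_eq_zero_of_moments_eq_zero hR hK fun m n => ?_
  have h1 := hcov m n
  rcases hmom with h | h <;> simpa [h, hc] using h1

/-- If a complex measure `h • P` supported on a compact `Γ ⊆ ℂ` with
`μ(Γ) ≠ 0` and `F·μ ≠ 0` satisfies the covariance equation with respect to a
continuous `F`, then `∫ |F|² dμ`, `∫ F dμ` and `∫ conj F dμ` are all nonzero. -/
theorem stmt_5 (Γ : Set ℂ) (hΓ : IsCompact Γ)
    (P : Measure ℂ) [IsFiniteMeasure P] (h : ℂ → ℂ)
    (hmeas : Measurable h) (hnorm : ∀ z, ‖h z‖ = 1)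
    (hsupp : P Γᶜ = 0)
    (hmass : ∫ z, h z ∂P ≠ 0)
    (F : ℂ → ℂ) (hF : ContinuousOn F Γ)
    (hFμ : ∃ s : Set ℂ, MeasurableSet s ∧ ∫ z in s, F z * h z ∂P ≠ 0)
    (hcov : ∀ m n : ℕ,
      (∫ z, h z ∂P) *
          ∫ z, z ^ n * (starRingEnd ℂ) z ^ m * ((‖F z‖ ^ 2 : ℝ) : ℂ) * h z ∂P
        = (∫ z, z ^ n * F z * h z ∂P) *
            ∫ z, (starRingEnd ℂ) z ^ m * (starRingEnd ℂ) (F z) * h z ∂P) :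
    (∫ z, ((‖F z‖ ^ 2 : ℝ) : ℂ) * h z ∂P ≠ 0) ∧
      (∫ z, F z * h z ∂P ≠ 0) ∧
      (∫ z, (starRingEnd ℂ) (F z) * h z ∂P ≠ 0) := by
  have hmem : ∀ᵐ z ∂P, z ∈ Γ := by rwa [ae_iff]
  have hrestrict : P.restrict Γ = P := Measure.restrict_eq_self_of_ae_mem hmem
  obtain ⟨R, hRΓ⟩ := hΓ.isBounded.exists_norm_le
  have hR : ∀ᵐ z ∂P, ‖z‖ ≤ R := hmem.mono hRΓ
  have hh : Integrable h P :=
    .of_bound hmeas.aestronglyMeasurable 1 (.of_forall fun z => (hnorm z).le)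
  have hint {φ : ℂ → ℂ} (hφ : ContinuousOn φ Γ) : Integrable (fun z => φ z * h z) P := by
    obtain ⟨C, hC⟩ := hΓ.exists_bound_of_continuousOn hφ
    have hm := hφ.aestronglyMeasurable (μ := P) hΓ.measurableSet
    rw [hrestrict] at hm
    exact hh.bdd_mul (c := C) hm (hmem.mono hC)
  have hne : ∫ z, ((‖F z‖ ^ 2 : ℝ) : ℂ) * h z ∂P ≠ 0 := by
    intro h0
    have hK := ae_eq_zero_of_moments_factor hR
      (hint (φ := fun z => ((‖F z‖ ^ 2 : ℝ) : ℂ))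
        (Complex.continuous_ofReal.comp_continuousOn (hF.norm.pow 2)))
      (hint hF) (hint (Complex.continuous_conj.comp_continuousOn hF)) hmass
      (fun m n => by simpa only [mul_assoc, Function.comp_apply] using hcov m n) h0
    obtain ⟨s, -, hs⟩ := hFμ
    refine hs (integral_eq_zero_of_ae (ae_restrict_of_ae (hK.mono fun z hz => ?_)))
    have hz' : h z ≠ 0 := norm_ne_zero_iff.1 (by simp [hnorm])
    have hFz : F z = 0 := by simpa [hz'] using hz
    simp [hFz]
  have hprod := mul_ne_zero hmass hne
  have h00 := hcov 0 0
  simp only [pow_zero, one_mul] at h00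
  rw [h00] at hprod
  exact ⟨hne, mul_ne_zero_iff.1 hprod⟩
end

section
/- Let S be a commutative monoid and μ a compactly supported complex regular Borel measure on the space S' of nonzero multiplicative functions on S, with μ(S') ≠ 0. Define γ(s) := (∫ ρ(s) dμ(ρ)) / μ(S'). Then μ satisfies μ(S')·∫ ρ(s)·conj(ρ(t)) dμ(ρ) = (∫ ρ(s) dμ(ρ))·(∫ conj(ρ(t)) dμ(ρ)) for all s, t ∈ S if and only if γ is a multiplicative function (γ ∈ S') and μ = μ(S')·δ_γ. -/
open MeasureTheory Complex
open scoped Classical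

/-- The space of nonzero multiplicative complex-valued functions on a
commutative monoid `S`, with the topology of pointwise convergence. -/
abbrev MultChar (S : Type*) [CommMonoid S] : Type _ :=
  {ρ : S → ℂ // (∀ s t : S, ρ (s * t) = ρ s * ρ t) ∧ ρ ≠ 0}

open scoped ComplexConjugate

/-- Measurable functions that are bounded almost everywhere. -/
def IsAEBdd {X : Type*} [MeasurableSpace X] (P : Measure X) (f : X → ℂ) : Prop :=
  Measurable f ∧ ∃ R : ℝ, ∀ᵐ x ∂P, ‖f x‖ ≤ R

namespace IsAEBdd

variable {X : Type*} [MeasurableSpace X] {P : Measure X} {f g : X → ℂ}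

theorem of_bound (hf : Measurable f) {R : ℝ} (hR : ∀ x, ‖f x‖ ≤ R) : IsAEBdd P f :=
  ⟨hf, R, ae_of_all _ hR⟩

theorem const (c : ℂ) : IsAEBdd P fun _ => c :=
  of_bound measurable_const fun _ => le_rfl

theorem mul (hf : IsAEBdd P f) (hg : IsAEBdd P g) : IsAEBdd P fun x => f x * g x := by
  obtain ⟨hf, A, hA⟩ := hf
  obtain ⟨hg, B, hB⟩ := hg
  refine ⟨hf.mul hg, A * B, ?_⟩
  filter_upwards [hA, hB] with x hx hy
  rw [norm_mul]
  exact mul_le_mul hx hy (norm_nonneg _) ((norm_nonneg _).trans hx)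

theorem add (hf : IsAEBdd P f) (hg : IsAEBdd P g) : IsAEBdd P fun x => f x + g x := by
  obtain ⟨hf, A, hA⟩ := hf
  obtain ⟨hg, B, hB⟩ := hg
  refine ⟨hf.add hg, A + B, ?_⟩
  filter_upwards [hA, hB] with x hx hy
  exact norm_add_le_of_le hx hy

theorem sub (hf : IsAEBdd P f) (hg : IsAEBdd P g) : IsAEBdd P fun x => f x - g x := by
  simpa [sub_eq_add_neg] using hf.add ((const (-1)).mul hg)

theorem conjugate (hf : IsAEBdd P f) : IsAEBdd P fun x => conj (f x) :=
  ⟨continuous_conj.measurable.comp hf.1, by simpa using hf.2⟩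

theorem pow (hf : IsAEBdd P f) (n : ℕ) : IsAEBdd P fun x => f x ^ n := by
  induction n with
  | zero => simpa using const 1
  | succ n ih => simpa [pow_succ] using ih.mul hf

theorem integrable [IsFiniteMeasure P] (hf : IsAEBdd P f) : Integrable f P :=
  hf.2.elim fun _ hR => .of_bound hf.1.aestronglyMeasurable _ hR

theorem fst {Y : Type*} [MeasurableSpace Y] {Q : Measure Y} [SFinite Q] (hf : IsAEBdd P f) :
    IsAEBdd (P.prod Q) fun p => f p.1 :=
  ⟨hf.1.comp measurable_fst, hf.2.imp fun _ h => Measure.quasiMeasurePreserving_fst.ae h⟩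

theorem snd {Y : Type*} [MeasurableSpace Y] {Q : Measure Y} [SFinite P] [SFinite Q] {f : Y → ℂ}
    (hf : IsAEBdd Q f) : IsAEBdd (P.prod Q) fun p => f p.2 :=
  ⟨hf.1.comp measurable_snd, hf.2.imp fun _ h => Measure.quasiMeasurePreserving_snd.ae h⟩

end IsAEBdd

/-- The polynomials in `w` and `conj w`, as functions on `ℂ`. -/
def starPolynomials : Submodule ℂ (ℂ → ℂ) :=
  Submodule.span ℂ (Set.range fun mn : ℕ × ℕ => fun w : ℂ => w ^ mn.1 * conj w ^ mn.2)

theorem continuous_of_mem_starPolynomials {p : ℂ → ℂ} (hp : p ∈ starPolynomials) :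
    Continuous p := by
  induction hp using Submodule.span_induction with
  | mem p hp =>
    obtain ⟨mn, rfl⟩ := hp
    dsimp only
    fun_prop
  | zero => exact continuous_const
  | add p q _ _ hp hq => exact hp.add hq
  | smul c p _ hp => exact hp.const_smul c

theorem exists_starPolynomial_near {f : ℂ → ℂ} (hf : Continuous f) (R : ℝ) {ε : ℝ} (hε : 0 < ε) :
    ∃ p ∈ starPolynomials, ∀ w, ‖w‖ ≤ R → ‖f w - p w‖ ≤ ε := by
  let K : Set ℂ := Metric.closedBall 0 R
  have : CompactSpace K := isCompact_iff_compactSpace.mp (isCompact_closedBall 0 R)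
  let F : C(K, ℂ) := ⟨fun w => f w, by fun_prop⟩
  have hF : F ∈ (polynomialFunctions K).starClosure.topologicalClosure := by
    rw [polynomialFunctions.starClosure_topologicalClosure]
    trivial
  obtain ⟨q, hq, hqF⟩ := Metric.mem_closure_iff.mp hF ε hε
  have key : ∀ q ∈ (polynomialFunctions K).starClosure,
      ∃ p ∈ starPolynomials, ∀ w : K, q w = p w := by
    intro q hq
    rw [polynomialFunctions.starClosure_eq_adjoin_X, ← StarSubalgebra.mem_toSubalgebra,
      StarAlgebra.adjoin_toSubalgebra, ← Subalgebra.mem_toSubmodule, Algebra.adjoin_eq_span,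
      Set.star_singleton, Set.singleton_union] at hq
    induction hq using Submodule.span_induction with
    | mem q hq =>
      obtain ⟨m, n, rfl⟩ := (Submonoid.mem_closure_pair _ _ _).mp hq
      exact ⟨_, Submodule.subset_span ⟨(m, n), rfl⟩, fun w => by simp⟩
    | zero => exact ⟨0, zero_mem _, fun w => by simp⟩
    | add q r _ _ hq hr =>
      obtain ⟨p, hp, hpq⟩ := hq
      obtain ⟨p', hp', hpr⟩ := hr
      exact ⟨p + p', add_mem hp hp', fun w => by simp [hpq, hpr]⟩
    | smul c q _ hq =>
      obtain ⟨p, hp, hpq⟩ := hq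
      exact ⟨c • p, Submodule.smul_mem _ c hp, fun w => by simp [hpq]⟩
  obtain ⟨p, hp, hqp⟩ := key q hq
  refine ⟨p, hp, fun w hw => ?_⟩
  have := (ContinuousMap.dist_apply_le_dist (f := F) (g := q)
    (⟨w, by simpa [K] using hw⟩ : K)).trans hqF.le
  rwa [dist_eq_norm, hqp] at this

theorem exists_starPolynomial_integral_sub_le (ν : Measure ℂ) [IsFiniteMeasure ν] {R : ℝ}
    (hR : ∀ᵐ w ∂ν, ‖w‖ ≤ R) {ψ : ℂ → ℂ} (hψ : Integrable ψ ν) {ε : ℝ} (hε : 0 < ε) :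
    ∃ p ∈ starPolynomials, Integrable p ν ∧ ∫ w, ‖ψ w - p w‖ ∂ν ≤ ε := by
  obtain ⟨f, -, hfψ, hfc, hfi⟩ := hψ.exists_hasCompactSupport_integral_sub_le (half_pos hε)
  obtain ⟨p, hp, hfp⟩ := exists_starPolynomial_near hfc R
    (show 0 < ε / 2 / (ν.real Set.univ + 1) by positivity)
  have hsub : Integrable (fun w => f w - p w) ν :=
    .of_bound (hfc.sub (continuous_of_mem_starPolynomials hp)).aestronglyMeasurable _
      (hR.mono hfp)
  have hpi : Integrable p ν := (hfi.sub hsub).congr (ae_of_all _ fun w => by simp)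
  refine ⟨p, hp, hpi, ?_⟩
  have h2 : ∫ w, ‖f w - p w‖ ∂ν ≤ ε / 2 := by
    calc ∫ w, ‖f w - p w‖ ∂ν ≤ ∫ _, ε / 2 / (ν.real Set.univ + 1) ∂ν :=
          integral_mono_ae hsub.norm (integrable_const _) (hR.mono hfp)
      _ = (ε / 2) * (ν.real Set.univ / (ν.real Set.univ + 1)) := by simp; ring
      _ ≤ ε / 2 := mul_le_of_le_one_right (by positivity)
          (div_le_one_of_le₀ (by linarith) (by positivity))
  calc ∫ w, ‖ψ w - p w‖ ∂ν ≤ ∫ w, (‖ψ w - f w‖ + ‖f w - p w‖) ∂ν :=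
        integral_mono (hψ.sub hpi).norm ((hψ.sub hfi).norm.add hsub.norm)
          fun w => norm_sub_le_norm_sub_add_norm_sub _ _ _
    _ = ∫ w, ‖ψ w - f w‖ ∂ν + ∫ w, ‖f w - p w‖ ∂ν :=
        integral_add (hψ.sub hfi).norm hsub.norm
    _ ≤ ε := by linarith

/-- A bounded complex density whose push-forward along a bounded function `z` has the moments of
`C • δ_{z₀}` has push-forward `C • δ_{z₀}`. -/
theorem integral_comp_mul_eq_of_moments {X : Type*} [MeasurableSpace X] {P : Measure X}
    [IsFiniteMeasure P] {z g : X → ℂ} (hz : IsAEBdd P z) (hg : IsAEBdd P g) {C z₀ : ℂ}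
    (hmom : ∀ m n : ℕ, ∫ x, z x ^ m * conj (z x) ^ n * g x ∂P = C * (z₀ ^ m * conj z₀ ^ n))
    {ψ : ℂ → ℂ} (hψ : Measurable ψ) {B : ℝ} (hB : ∀ w, ‖ψ w‖ ≤ B) :
    ∫ x, ψ (z x) * g x ∂P = C * ψ z₀ := by
  obtain ⟨R, hR⟩ := hz.2
  obtain ⟨M, hM⟩ := hg.2
  let ν : Measure ℂ := P.map z + Measure.dirac z₀
  have hνR : ∀ᵐ w ∂ν, ‖w‖ ≤ max R ‖z₀‖ := by
    have hm : MeasurableSet {w : ℂ | ‖w‖ ≤ max R ‖z₀‖} :=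
      measurableSet_le measurable_norm measurable_const
    rw [ae_add_measure_iff, ae_map_iff hz.1.aemeasurable hm, ae_dirac_iff hm]
    exact ⟨hR.mono fun x hx => le_max_of_le_left hx, le_max_right _ _⟩
  have hψν : Integrable ψ ν := .of_bound hψ.aestronglyMeasurable _ (ae_of_all _ hB)
  have hpoly : ∀ p ∈ starPolynomials, IsAEBdd P (fun x => p (z x)) ∧
      ∫ x, p (z x) * g x ∂P = C * p z₀ := by
    intro p hp
    induction hp using Submodule.span_induction with
    | mem p hp =>
      obtain ⟨⟨m, n⟩, rfl⟩ := hp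
      exact ⟨(hz.pow m).mul (hz.conjugate.pow n), hmom m n⟩
    | zero => exact ⟨.const 0, by simp⟩
    | add p q _ _ hp hq =>
      refine ⟨hp.1.add hq.1, ?_⟩
      simp only [Pi.add_apply, add_mul, mul_add]
      rw [integral_add (hp.1.mul hg).integrable (hq.1.mul hg).integrable, hp.2, hq.2]
    | smul c p _ hp =>
      refine ⟨(IsAEBdd.const c).mul hp.1, ?_⟩
      simp only [Pi.smul_apply, smul_eq_mul, mul_assoc]
      rw [integral_const_mul, hp.2]
      ring
  have hψz : IsAEBdd P fun x => ψ (z x) := .of_bound (hψ.comp hz.1) fun x => hB _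
  refine eq_of_forall_dist_le fun ε hε => ?_
  obtain ⟨p, hp, hpi, hψp⟩ := exists_starPolynomial_integral_sub_le ν hνR hψν
    (show 0 < ε / (|M| + ‖C‖ + 1) by positivity)
  obtain ⟨hpz, hpI⟩ := hpoly p hp
  have hmeas : Measurable fun w => ‖ψ w - p w‖ :=
    (hψ.sub (continuous_of_mem_starPolynomials hp).measurable).norm
  have hsplit : ∫ w, ‖ψ w - p w‖ ∂ν = ∫ x, ‖ψ (z x) - p (z x)‖ ∂P + ‖ψ z₀ - p z₀‖ := by
    have hi : Integrable (fun w => ‖ψ w - p w‖) (P.map z) ∧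
        Integrable (fun w => ‖ψ w - p w‖) (Measure.dirac z₀) :=
      integrable_add_measure.mp (hψν.sub hpi).norm
    rw [integral_add_measure hi.1 hi.2, integral_map hz.1.aemeasurable hmeas.aestronglyMeasurable,
      integral_dirac' _ _ hmeas.stronglyMeasurable]
  have h1 : ‖∫ x, (ψ (z x) - p (z x)) * g x ∂P‖ ≤ |M| * ∫ x, ‖ψ (z x) - p (z x)‖ ∂P := by
    rw [← integral_const_mul]
    refine norm_integral_le_of_norm_le ((hψz.sub hpz).integrable.norm.const_mul _) ?_
    filter_upwards [hM] with x hx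
    rw [norm_mul, mul_comm]
    exact mul_le_mul_of_nonneg_right (hx.trans (le_abs_self M)) (norm_nonneg _)
  have h2 : ∫ x, ψ (z x) * g x ∂P - C * ψ z₀ =
      ∫ x, (ψ (z x) - p (z x)) * g x ∂P - C * (ψ z₀ - p z₀) := by
    simp only [sub_mul, mul_sub]
    rw [integral_sub (hψz.mul hg).integrable (hpz.mul hg).integrable, hpI]
    ring
  have h3 : 0 ≤ ∫ x, ‖ψ (z x) - p (z x)‖ ∂P := integral_nonneg fun _ => norm_nonneg _
  rw [dist_eq_norm, h2]
  calc _ ≤ |M| * ∫ x, ‖ψ (z x) - p (z x)‖ ∂P + ‖C‖ * ‖ψ z₀ - p z₀‖ :=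
        (norm_sub_le _ _).trans (add_le_add h1 (norm_mul_le _ _))
    _ ≤ (|M| + ‖C‖ + 1) * ∫ w, ‖ψ w - p w‖ ∂ν := by
        rw [hsplit]
        nlinarith [abs_nonneg M, norm_nonneg C, norm_nonneg (ψ z₀ - p z₀),
          mul_nonneg (norm_nonneg C) h3, mul_nonneg (abs_nonneg M) (norm_nonneg (ψ z₀ - p z₀))]
    _ ≤ (|M| + ‖C‖ + 1) * (ε / (|M| + ‖C‖ + 1)) := by gcongr
    _ = ε := by field_simp

theorem integral_mul_conj_factor_of_mem_span {X : Type*} [MeasurableSpace X] {P : Measure X}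
    [IsFiniteMeasure P] {h : X → ℂ} (hh : IsAEBdd P h) {A : Set (X → ℂ)}
    (hA : ∀ f ∈ A, IsAEBdd P f) {c : ℂ}
    (hfac : ∀ f ∈ A, ∀ g ∈ A, c * ∫ x, f x * conj (g x) * h x ∂P
      = (∫ x, f x * h x ∂P) * ∫ x, conj (g x) * h x ∂P)
    {f g : X → ℂ} (hf : f ∈ Submodule.span ℂ A) (hg : g ∈ Submodule.span ℂ A) :
    c * ∫ x, f x * conj (g x) * h x ∂P
      = (∫ x, f x * h x ∂P) * ∫ x, conj (g x) * h x ∂P := by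
  have hbdd : ∀ f ∈ Submodule.span ℂ A, IsAEBdd P f := by
    intro f hf
    induction hf using Submodule.span_induction with
    | mem f hf => exact hA f hf
    | zero => exact .const 0
    | add f g _ _ hf hg => exact hf.add hg
    | smul a f _ hf => exact (IsAEBdd.const a).mul hf
  induction hf using Submodule.span_induction with
  | mem f hf =>
    induction hg using Submodule.span_induction with
    | mem g hg => exact hfac f hf g hg
    | zero => simp
    | add g g' hg hg' ih ih' =>
      have hf := hA f hf
      have hg := (hbdd g hg).conjugate
      have hg' := (hbdd g' hg').conjugate
      simp only [Pi.add_apply, map_add, mul_add, add_mul]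
      rw [integral_add ((hf.mul hg).mul hh).integrable ((hf.mul hg').mul hh).integrable,
        integral_add (hg.mul hh).integrable (hg'.mul hh).integrable, mul_add, mul_add, ih, ih']
    | smul a g hg ih =>
      simp only [Pi.smul_apply, smul_eq_mul, map_mul, mul_left_comm _ (conj a), mul_assoc]
      simp only [mul_assoc] at ih
      rw [integral_const_mul, integral_const_mul]
      linear_combination conj a * ih
  | zero => simp
  | add f f' hf hf' ih ih' =>
    have hg := (hbdd g hg).conjugate
    have hf := hbdd f hf
    have hf' := hbdd f' hf'
    simp only [Pi.add_apply, add_mul]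
    rw [integral_add ((hf.mul hg).mul hh).integrable ((hf'.mul hg).mul hh).integrable,
      integral_add (hf.mul hh).integrable (hf'.mul hh).integrable, mul_add, add_mul, ih, ih']
  | smul a f hf ih =>
    simp only [Pi.smul_apply, smul_eq_mul, mul_assoc]
    simp only [mul_assoc] at ih
    rw [integral_const_mul, integral_const_mul]
    linear_combination a * ih

section Monoid

variable {M X : Type*} [CommMonoid M] [MeasurableSpace X]

/-- The product characters `(x, y) ↦ χ a x * χ b y`. -/
def prodChar (χ : M →* (X → ℂ)) : M × M →* (X × X → ℂ) where
  toFun a p := χ a.1 p.1 * χ a.2 p.2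
  map_one' := by ext; simp
  map_mul' a b := by
    ext
    simp only [Prod.fst_mul, Prod.snd_mul, map_mul, Pi.mul_apply]
    ring

variable {P : Measure X} [IsFiniteMeasure P] {h : X → ℂ} {χ : M →* (X → ℂ)}

theorem integral_mul_of_factor (hh : IsAEBdd P h) (hχ : ∀ a, IsAEBdd P (χ a))
    (hc : ∫ x, h x ∂P ≠ 0)
    (hfac : ∀ a b, (∫ x, h x ∂P) * ∫ x, χ a x * conj (χ b x) * h x ∂P
      = (∫ x, χ a x * h x ∂P) * ∫ x, conj (χ b x) * h x ∂P) (s t : M) :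
    (∫ x, h x ∂P) * ∫ x, χ (s * t) x * h x ∂P
      = (∫ x, χ s x * h x ∂P) * ∫ x, χ t x * h x ∂P := by
  set c := ∫ x, h x ∂P with hc_def
  let H : X × X → ℂ := fun p => h p.1 * h p.2
  have hH : IsAEBdd (P.prod P) H := hh.fst.mul hh.snd
  let E := prodChar χ
  have hE : ∀ a, IsAEBdd (P.prod P) (E a) := fun a => (hχ a.1).fst.mul (hχ a.2).snd
  have hEint : ∀ a b, ∫ p, E (a, b) p * H p ∂(P.prod P)
      = (∫ x, χ a x * h x ∂P) * ∫ x, χ b x * h x ∂P := by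
    intro a b
    rw [← integral_prod_mul]
    congr 1 with p
    simp only [E, H, prodChar, MonoidHom.coe_mk, OneHom.coe_mk]
    ring
  have hEconj : ∀ a b, ∫ p, conj (E (a, b) p) * H p ∂(P.prod P)
      = (∫ x, conj (χ a x) * h x ∂P) * ∫ x, conj (χ b x) * h x ∂P := by
    intro a b
    rw [← integral_prod_mul]
    congr 1 with p
    simp only [E, H, prodChar, MonoidHom.coe_mk, OneHom.coe_mk, map_mul]
    ring
  have hEE : ∀ a b, ∫ p, E a p * conj (E b p) * H p ∂(P.prod P)
      = (∫ x, χ a.1 x * conj (χ b.1 x) * h x ∂P) * ∫ x, χ a.2 x * conj (χ b.2 x) * h x ∂P := by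
    intro a b
    rw [← integral_prod_mul]
    congr 1 with p
    simp only [E, H, prodChar, MonoidHom.coe_mk, OneHom.coe_mk, map_mul]
    ring
  let 𝒞 : Subalgebra ℂ (X × X → ℂ) := Algebra.adjoin ℂ (Set.range E)
  have h𝒞 : ∀ F ∈ 𝒞, F ∈ Submodule.span ℂ (Set.range E) := by
    intro F hF
    rw [← Subalgebra.mem_toSubmodule, Algebra.adjoin_eq_span, ← MonoidHom.coe_mrange,
      Submonoid.closure_eq] at hF
    exact hF
  have hfac2 : ∀ F ∈ 𝒞, ∀ G ∈ 𝒞, c ^ 2 * ∫ p, F p * conj (G p) * H p ∂(P.prod P)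
      = (∫ p, F p * H p ∂(P.prod P)) * ∫ p, conj (G p) * H p ∂(P.prod P) := by
    intro F hF G hG
    refine integral_mul_conj_factor_of_mem_span hH ?_ ?_ (h𝒞 F hF) (h𝒞 G hG)
    · rintro _ ⟨a, rfl⟩
      exact hE a
    · rintro _ ⟨⟨a, a'⟩, rfl⟩ _ ⟨⟨b, b'⟩, rfl⟩
      rw [hEE, hEint, hEconj]
      linear_combination (c * ∫ x, χ a' x * conj (χ b' x) * h x ∂P) * hfac a b
        + ((∫ x, χ a x * h x ∂P) * ∫ x, conj (χ b x) * h x ∂P) * hfac a' b'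
  have hanti : ∀ F : X × X → ℂ, (∀ p, F p.swap = -F p) →
      ∫ p, F p * H p ∂(P.prod P) = 0 := by
    intro F hF
    have hsw := integral_prod_swap (μ := P) (ν := P) (fun p => F p * H p)
    have hneg : ∀ p : X × X, F p.swap * H p.swap = -(F p * H p) := by
      intro p
      rw [hF]
      simp only [H, Prod.fst_swap, Prod.snd_swap]
      ring
    simp only [hneg, integral_neg] at hsw
    exact self_eq_neg.mp hsw.symm
  let w : X × X → ℂ := E (s, 1) - E (1, s)
  let f : X × X → ℂ := E (t, 1) - E (1, t)
  have hw𝒞 : w ∈ 𝒞 := sub_mem (Algebra.subset_adjoin ⟨_, rfl⟩) (Algebra.subset_adjoin ⟨_, rfl⟩)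
  have hf𝒞 : f ∈ 𝒞 := sub_mem (Algebra.subset_adjoin ⟨_, rfl⟩) (Algebra.subset_adjoin ⟨_, rfl⟩)
  have hw : IsAEBdd (P.prod P) w := (hE _).sub (hE _)
  have hf : IsAEBdd (P.prod P) f := (hE _).sub (hE _)
  have hw_swap : ∀ p, w p.swap = -w p := fun p => by simp [w, E, prodChar]
  have hf_swap : ∀ p, f p.swap = -f p := fun p => by simp [f, E, prodChar]
  have hmom : ∀ m n : ℕ, ∫ p, (w p ^ 2) ^ m * conj (w p ^ 2) ^ n * (f p * conj (w p) * H p)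
      ∂(P.prod P) = 0 * ((0 : ℂ) ^ m * conj (0 : ℂ) ^ n) := by
    intro m n
    have h0 := hfac2 (f * w ^ (2 * m)) (mul_mem hf𝒞 (pow_mem hw𝒞 _)) (w ^ (2 * n + 1))
      (pow_mem hw𝒞 _)
    rw [hanti (f * w ^ (2 * m)) fun p => by simp [hw_swap, hf_swap, pow_mul], zero_mul] at h0
    rw [zero_mul, ← (mul_eq_zero_iff_left (pow_ne_zero 2 hc)).mp h0]
    congr 1 with p
    simp only [Pi.mul_apply, Pi.pow_apply, map_pow]
    ring
  have hdir := integral_comp_mul_eq_of_moments (hw.pow 2) ((hf.mul hw.conjugate).mul hH) hmom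
    (ψ := fun v => v / ‖v‖) (by fun_prop) (B := 1) fun v => by
      simpa using div_self_le_one ‖v‖
  have hfw : ∫ p, f p * w p * H p ∂(P.prod P) = 0 := by
    rw [zero_mul] at hdir
    rw [← hdir]
    congr 1 with p
    rcases eq_or_ne (w p) 0 with h0 | h0
    · simp [h0]
    · have hn : ((‖w p ^ 2‖ : ℝ) : ℂ) = w p * conj (w p) := by
        rw [norm_pow, Complex.mul_conj, Complex.normSq_eq_norm_sq]
      have hcw : conj (w p) ≠ 0 := by simpa using h0
      rw [hn]
      field_simp
  have hexp : ∀ p, f p * w p * H p = (E (t * s, 1) p * H p - E (t, s) p * H p)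
      - (E (s, t) p * H p - E (1, t * s) p * H p) := by
    intro p
    simp only [f, w, E, prodChar, MonoidHom.coe_mk, OneHom.coe_mk, Pi.sub_apply, map_mul, map_one,
      Pi.mul_apply, Pi.one_apply]
    ring
  have hi : ∀ a, Integrable (fun p => E a p * H p) (P.prod P) := fun a =>
    ((hE a).mul hH).integrable
  simp only [hexp] at hfw
  have hi2 : ∀ a b, Integrable (fun p => E a p * H p - E b p * H p) (P.prod P) := fun a b =>
    (hi a).sub (hi b)
  rw [integral_sub (hi2 _ _) (hi2 _ _), integral_sub (hi _) (hi _),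
    integral_sub (hi _) (hi _)] at hfw
  simp only [hEint, map_one, Pi.one_apply, one_mul, mul_comm t s, ← hc_def] at hfw
  linear_combination hfw / 2

theorem integral_conj_eq_of_factor (hh : IsAEBdd P h) (hχ : ∀ a, IsAEBdd P (χ a)) {c : ℂ}
    (hc : c ≠ 0) {γ : M →* ℂ} (hγ : ∀ a, ∫ x, χ a x * h x ∂P = c * γ a)
    (hfac : ∀ a b, c * ∫ x, χ a x * conj (χ b x) * h x ∂P
      = (∫ x, χ a x * h x ∂P) * ∫ x, conj (χ b x) * h x ∂P) (b : M) :
    ∫ x, conj (χ b x) * h x ∂P = c * conj (γ b) := by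
  have hmom : ∀ m n : ℕ, ∫ x, χ b x ^ m * conj (χ b x) ^ n * ((χ b x - γ b) * h x) ∂P
      = 0 * (γ b ^ m * conj (γ b) ^ n) := by
    intro m n
    have hexp : ∀ x, χ b x ^ m * conj (χ b x) ^ n * ((χ b x - γ b) * h x)
        = χ (b ^ (m + 1)) x * conj (χ (b ^ n) x) * h x
          - γ b * (χ (b ^ m) x * conj (χ (b ^ n) x) * h x) := by
      intro x
      simp only [map_pow, Pi.pow_apply]
      ring
    have hi : ∀ a a', Integrable (fun x => χ a x * conj (χ a' x) * h x) P := fun a a' =>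
      (((hχ a).mul (hχ a').conjugate).mul hh).integrable
    simp only [hexp]
    rw [integral_sub (hi _ _) ((hi _ _).const_mul _), integral_const_mul, zero_mul]
    have h1 := hfac (b ^ (m + 1)) (b ^ n)
    have h2 := hfac (b ^ m) (b ^ n)
    rw [hγ, map_pow γ] at h1 h2
    refine mul_left_cancel₀ hc ?_
    linear_combination h1 - γ b * h2
  have hdir := integral_comp_mul_eq_of_moments (hχ b) (((hχ b).sub (.const (γ b))).mul hh) hmom
    (ψ := fun v => conj (v - γ b) / (v - γ b)) (by fun_prop) (B := 1) fun v => by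
      simpa only [norm_div, RCLike.norm_conj] using div_self_le_one ‖v - γ b‖
  have hzero : ∫ x, (conj (χ b x) * h x - conj (γ b) * (χ 1 x * h x)) ∂P = 0 := by
    rw [zero_mul] at hdir
    rw [← hdir]
    congr 1 with x
    simp only [map_one, Pi.one_apply]
    rcases eq_or_ne (χ b x) (γ b) with h0 | h0
    · simp [h0]
    · have h0' : χ b x - γ b ≠ 0 := sub_ne_zero.mpr h0
      rw [map_sub]
      field_simp
  rw [integral_sub ((hχ b).conjugate.mul hh).integrable
    (((hχ 1).mul hh).integrable.const_mul _), integral_const_mul, hγ, map_one] at hzero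
  linear_combination hzero

theorem integral_prod_comp_eq_of_moments (hh : IsAEBdd P h) (hχ : ∀ a, IsAEBdd P (χ a)) {c : ℂ}
    {γ : M →* ℂ}
    (hγ : ∀ a b, ∫ x, χ a x * conj (χ b x) * h x ∂P = c * (γ a * conj (γ b)))
    {φ : M → ℂ → ℂ} (hφ : ∀ i, Measurable (φ i)) (hφ1 : ∀ i w, ‖φ i w‖ ≤ 1) (F : Finset M)
    (a b : M) :
    ∫ x, χ a x * conj (χ b x) * ((∏ i ∈ F, φ i (χ i x)) * h x) ∂P
      = c * (γ a * conj (γ b) * ∏ i ∈ F, φ i (γ i)) := by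
  classical
  induction F using Finset.induction_on generalizing a b with
  | empty => simpa using hγ a b
  | insert i F hi ih =>
    have hprod : IsAEBdd P fun x => ∏ i ∈ F, φ i (χ i x) := by
      refine .of_bound (R := 1) (Finset.measurable_fun_prod F fun i _ => (hφ i).comp (hχ i).1) ?_
      intro x
      rw [norm_prod]
      exact Finset.prod_le_one (fun _ _ => norm_nonneg _) fun i _ => hφ1 i _
    have hdir := integral_comp_mul_eq_of_moments (hχ i)
      (g := fun x => χ a x * conj (χ b x) * ((∏ i ∈ F, φ i (χ i x)) * h x))
      (((hχ a).mul (hχ b).conjugate).mul (hprod.mul hh))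
      (C := c * (γ a * conj (γ b) * ∏ i ∈ F, φ i (γ i))) (z₀ := γ i) (fun m n => by
        have := ih (i ^ m * a) (i ^ n * b)
        simp only [map_mul, map_pow] at this
        rw [show c * (γ a * conj (γ b) * ∏ i ∈ F, φ i (γ i)) * (γ i ^ m * conj (γ i) ^ n)
          = c * (γ i ^ m * γ a * (conj (γ i) ^ n * conj (γ b)) * ∏ i ∈ F, φ i (γ i)) by ring,
          ← this]
        congr 1 with x
        simp only [Pi.mul_apply, Pi.pow_apply, map_mul, map_pow]
        ring) (hφ i) (hφ1 i)
    simp only [Finset.prod_insert hi]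
    rw [show c * (γ a * conj (γ b) * (φ i (γ i) * ∏ i ∈ F, φ i (γ i)))
      = c * (γ a * conj (γ b) * ∏ i ∈ F, φ i (γ i)) * φ i (γ i) by ring, ← hdir]
    congr 1 with x
    ring

end Monoid

namespace MultChar

variable {S : Type*} [CommMonoid S]

theorem map_one (ρ : MultChar S) : ρ.1 1 = 1 := by
  obtain ⟨s, hs⟩ := Function.ne_iff.mp ρ.2.2
  have := ρ.2.1 1 s
  rw [one_mul] at this
  exact (mul_eq_right₀ hs).mp this.symm

/-- Evaluation of multiplicative functions, as a monoid homomorphism. -/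
def eval (S : Type*) [CommMonoid S] : S →* (MultChar S → ℂ) where
  toFun s ρ := ρ.1 s
  map_one' := funext map_one
  map_mul' s t := funext fun ρ => ρ.2.1 s t

theorem measurable_eval (s : S) : Measurable (eval S s) :=
  (measurable_pi_apply s).comp measurable_subtype_coe

theorem isAEBdd_eval {P : Measure (MultChar S)} {K : Set (MultChar S)} (hK : IsCompact K)
    (hPK : P Kᶜ = 0) (s : S) : IsAEBdd P (eval S s) := by
  have hc : Continuous (eval S s) := (continuous_apply s).comp continuous_subtype_val
  obtain ⟨R, hR⟩ := hK.exists_bound_of_continuousOn hc.continuousOn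
  refine ⟨measurable_eval s, R, ?_⟩
  filter_upwards [show ∀ᵐ ρ ∂P, ρ ∈ K from hPK] with ρ hρ using hR ρ hρ

/-- A bounded complex density on `MultChar S` integrating products of bounded one-coordinate
functions like `c • δ_{γ₀}` defines the measure `c • δ_{γ₀}`. -/
theorem setIntegral_eq_of_prod {P : Measure (MultChar S)} [IsFiniteMeasure P]
    {h : MultChar S → ℂ} (hh : Integrable h P) {c : ℂ} {γ₀ : MultChar S}
    (hprod : ∀ φ : S → ℂ → ℂ, (∀ i, Measurable (φ i)) → (∀ i w, ‖φ i w‖ ≤ 1) → ∀ F : Finset S,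
      ∫ ρ, (∏ i ∈ F, φ i (ρ.1 i)) * h ρ ∂P = c * ∏ i ∈ F, φ i (γ₀.1 i))
    {A : Set (MultChar S)} (hA : MeasurableSet A) :
    ∫ ρ in A, h ρ ∂P = ∫ _ in A, c ∂(Measure.dirac γ₀) := by
  have huniv : ∫ ρ, h ρ ∂P = ∫ _, c ∂(Measure.dirac γ₀) := by
    simpa using hprod (fun _ _ => 0) (fun _ => measurable_const) (by simp) ∅
  have hgen : (inferInstance : MeasurableSpace (MultChar S)) = MeasurableSpace.generateFrom
      (Set.preimage Subtype.val '' squareCylinders fun _ : S => {s : Set ℂ | MeasurableSet s}) := by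
    rw [← MeasurableSpace.comap_generateFrom, generateFrom_squareCylinders]
    rfl
  have hpi : IsPiSystem (Set.preimage (Subtype.val : MultChar S → S → ℂ) ''
      squareCylinders fun _ : S => {s : Set ℂ | MeasurableSet s}) :=
    IsPiSystem.comap (isPiSystem_squareCylinders
      (fun _ => MeasurableSpace.isPiSystem_measurableSet) (by simp)) _
  induction A, hA using MeasurableSpace.induction_on_inter hgen hpi with
  | empty => simp
  | basic A hA =>
    obtain ⟨_, ⟨F, t, ht, rfl⟩, rfl⟩ := hA
    have ht : ∀ i, MeasurableSet (t i) := fun i => ht i trivial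
    have hmeas : MeasurableSet ((Subtype.val : MultChar S → S → ℂ) ⁻¹' (F : Set S).pi t) :=
      measurable_subtype_coe (MeasurableSet.pi F.countable_toSet fun i _ => ht i)
    have hind : ∀ ρ : MultChar S, ∏ i ∈ F, (t i).indicator (fun _ => (1 : ℂ)) (ρ.1 i)
        = if ρ.1 ∈ (F : Set S).pi t then 1 else 0 := by
      intro ρ
      simp only [Set.indicator_apply, Finset.prod_ite_zero, Finset.prod_const_one, Set.mem_pi,
        Finset.mem_coe]
    have := hprod (fun i => (t i).indicator fun _ => 1)
      (fun i => measurable_const.indicator (ht i))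
      (fun i w => (norm_indicator_le_norm_self _ _).trans (by simp)) F
    simp only [hind, ite_mul, one_mul, zero_mul] at this
    rw [setIntegral_dirac' stronglyMeasurable_const _ hmeas, ← integral_indicator hmeas]
    simpa [Set.indicator_apply] using this
  | compl A hA ih =>
    have h1 := integral_add_compl hA hh
    have h2 := integral_add_compl hA (integrable_const (μ := Measure.dirac γ₀) c)
    rw [ih] at h1
    rw [← h2] at huniv
    exact add_left_cancel (h1.trans huniv)
  | iUnion A hd hA ih =>
    have h1 := hasSum_integral_iUnion hA hd hh.integrableOn
    have h2 := hasSum_integral_iUnion hA hd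
      (integrable_const (μ := Measure.dirac γ₀) c).integrableOn
    simp only [ih] at h1
    exact h1.unique h2

end MultChar

/-- If the complex measure `h • P` with unimodular `h` is a multiple of `δ_{x₀}`, then every
measurable function is `P`-almost everywhere equal to its value at `x₀`. -/
theorem ae_eq_const_of_setIntegral_eq_dirac {X : Type*} [MeasurableSpace X] {P : Measure X}
    [IsFiniteMeasure P] {h : X → ℂ} (hh : Integrable h P) (hnorm : ∀ x, ‖h x‖ = 1) {c : ℂ} {x₀ : X}
    (hA : ∀ A : Set X, MeasurableSet A → ∫ x in A, h x ∂P = if x₀ ∈ A then c else 0)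
    {f : X → ℂ} (hf : Measurable f) : ∀ᵐ x ∂P, f x = f x₀ := by
  let A : Set X := {x | f x ≠ f x₀}
  have hAm : MeasurableSet A := hf (measurableSet_singleton (f x₀)).compl
  have hzero : h =ᵐ[P.restrict A] 0 := by
    refine Integrable.ae_eq_zero_of_forall_setIntegral_eq_zero hh.integrableOn fun B hB _ => ?_
    rw [Measure.restrict_restrict hB, hA _ (hB.inter hAm), if_neg fun h => h.2 rfl]
  filter_upwards [(ae_restrict_iff' hAm).mp hzero] with x hx
  by_contra hne
  simpa [hx hne] using hnorm x

/-- A compactly supported complex measure `h • P` on `S'` with nonzero total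
mass satisfies the covariance equation iff `γ(s) = (∫ ρ(s) dμ)/μ(S')` is a
nonzero multiplicative function and `μ = μ(S')·δ_γ`. -/
theorem stmt_9 {S : Type*} [CommMonoid S]
    (P : Measure (MultChar S)) [IsFiniteMeasure P]
    (h : MultChar S → ℂ) (hmeas : Measurable h) (hnorm : ∀ ρ, ‖h ρ‖ = 1)
    (hsupp : ∃ K : Set (MultChar S), IsCompact K ∧ P Kᶜ = 0)
    (hmass : ∫ ρ, h ρ ∂P ≠ 0)
    (γ : S → ℂ) (hγ : γ = fun s => (∫ ρ, ρ.1 s * h ρ ∂P) / (∫ ρ, h ρ ∂P)) :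
    (∀ s t : S,
      (∫ ρ, h ρ ∂P) * ∫ ρ, ρ.1 s * (starRingEnd ℂ) (ρ.1 t) * h ρ ∂P
        = (∫ ρ, ρ.1 s * h ρ ∂P) * ∫ ρ, (starRingEnd ℂ) (ρ.1 t) * h ρ ∂P)
      ↔ ∃ (hmul : ∀ s t : S, γ (s * t) = γ s * γ t) (hne : γ ≠ 0),
          ∀ A : Set (MultChar S), MeasurableSet A →
            ∫ ρ in A, h ρ ∂P =
              if (⟨γ, hmul, hne⟩ : MultChar S) ∈ A then ∫ ρ, h ρ ∂P else 0 := by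
  have hh : IsAEBdd P h := .of_bound hmeas fun ρ => (hnorm ρ).le
  set c := ∫ ρ, h ρ ∂P with hc
  have hγc : ∀ s, ∫ ρ, ρ.1 s * h ρ ∂P = c * γ s := fun s => by
    rw [hγ]
    field_simp
  constructor
  · intro hfac
    obtain ⟨K, hK, hPK⟩ := hsupp
    have hχ : ∀ s, IsAEBdd P (MultChar.eval S s) := MultChar.isAEBdd_eval hK hPK
    have hmul : ∀ s t : S, γ (s * t) = γ s * γ t := by
      intro s t
      have h1 : c * ∫ ρ, ρ.1 (s * t) * h ρ ∂P
          = (∫ ρ, ρ.1 s * h ρ ∂P) * ∫ ρ, ρ.1 t * h ρ ∂P :=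
        integral_mul_of_factor hh hχ hmass hfac s t
      rw [hγc, hγc, hγc] at h1
      refine mul_left_cancel₀ (pow_ne_zero 2 hmass) ?_
      linear_combination h1
    have hone : γ 1 = 1 := by
      have h1 := hγc 1
      simp only [MultChar.map_one, one_mul, ← hc] at h1
      exact (mul_eq_left₀ hmass).mp h1.symm
    have hne : γ ≠ 0 := fun h0 => by simp [h0] at hone
    refine ⟨hmul, hne, fun A hA => ?_⟩
    let γ' : S →* ℂ := ⟨⟨γ, hone⟩, hmul⟩
    have hconj := integral_conj_eq_of_factor (γ := γ') hh hχ hmass hγc hfac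
    have hmom : ∀ a b, ∫ ρ, MultChar.eval S a ρ * conj (MultChar.eval S b ρ) * h ρ ∂P
        = c * (γ' a * conj (γ' b)) := by
      intro a b
      refine mul_left_cancel₀ hmass ?_
      refine (hfac a b).trans ?_
      rw [hγc, show ∫ ρ, conj (ρ.1 b) * h ρ ∂P = c * conj (γ' b) from hconj b]
      simp only [γ', MonoidHom.coe_mk, OneHom.coe_mk]
      ring
    rw [MultChar.setIntegral_eq_of_prod (γ₀ := ⟨γ, hmul, hne⟩) (c := c) hh.integrable ?_ hA,
      setIntegral_dirac' stronglyMeasurable_const _ hA]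
    intro φ hφ hφ1 F
    have := integral_prod_comp_eq_of_moments hh hχ hmom hφ hφ1 F 1 1
    simp only [map_one, Pi.one_apply, one_mul] at this
    exact this
  · rintro ⟨hmul, hne, hA⟩ s t
    have hconst := fun a => ae_eq_const_of_setIntegral_eq_dirac hh.integrable hnorm hA
      (MultChar.measurable_eval a)
    have h1 : ∫ ρ, ρ.1 s * conj (ρ.1 t) * h ρ ∂P = γ s * conj (γ t) * c := by
      rw [hc, ← integral_const_mul]
      refine integral_congr_ae ?_
      filter_upwards [hconst s, hconst t] with ρ hs ht
      rw [show ρ.1 s = γ s from hs, show ρ.1 t = γ t from ht]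
    have h2 : ∫ ρ, conj (ρ.1 t) * h ρ ∂P = conj (γ t) * c := by
      rw [hc, ← integral_const_mul]
      refine integral_congr_ae ?_
      filter_upwards [hconst t] with ρ ht
      rw [show ρ.1 t = γ t from ht]
    rw [h1, h2, hγc]
    ring
end

section
/- Let μ be a compactly supported complex Borel measure on ℂ^d with μ(ℂ^d) ≠ 0 satisfying μ(ℂ^d)·∫ zⁿ conj(z)ᵐ dμ = (∫ zⁿ dμ)(∫ conj(z)ᵐ dμ) for all multi-indices m, n ∈ ℕ^d. Then μ = c·δ_ζ with c = μ(ℂ^d) and ζ = (1/μ(ℂ^d))·(∫ z₁ dμ, …, ∫ z_d dμ). -/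
open MeasureTheory Complex
open scoped Classical BigOperators

open scoped ComplexConjugate

/-- The functional `x ↦ conj (L (star x))`. -/
noncomputable def conjStar {A : Type*} [CommCStarAlgebra A] (L : A →L[ℂ] ℂ) : A →L[ℂ] ℂ :=
  ((starL ℂ : ℂ ≃L⋆[ℂ] ℂ) : ℂ →L⋆[ℂ] ℂ).comp
    (L.comp ((starL ℂ : A ≃L⋆[ℂ] A) : A →L⋆[ℂ] A))

theorem conjStar_apply {A : Type*} [CommCStarAlgebra A] (L : A →L[ℂ] ℂ) (x : A) :
    conjStar L x = conj (L (star x)) := rfl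

theorem norm_exp_sub_star {A : Type*} [CommCStarAlgebra A] [Nontrivial A] (x : A) :
    ‖NormedSpace.exp (x - star x)‖ = 1 := by
  let _ : NormedAlgebra ℚ A := NormedAlgebra.restrictScalars ℚ ℂ A
  apply CStarRing.norm_of_mem_unitary
  apply NormedSpace.exp_mem_unitary_of_mem_skewAdjoint
  simp [skewAdjoint.mem_iff]

theorem exp_mul_star_exp_neg {A : Type*} [CommCStarAlgebra A] (x : A) :
    NormedSpace.exp x * star (NormedSpace.exp (-x)) = NormedSpace.exp (x - star x) := by
  let _ : NormedAlgebra ℚ A := NormedAlgebra.restrictScalars ℚ ℂ A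
  rw [NormedSpace.star_exp, ← NormedSpace.exp_add, star_neg, sub_eq_add_neg]

theorem eq_const_of_norm_le {φ : ℂ → ℂ} (hφ : Differentiable ℂ φ) {C : ℝ}
    (hC : ∀ t, ‖φ t‖ ≤ C) (t : ℂ) : φ t = φ 0 := by
  apply hφ.apply_eq_apply_of_bounded
  exact isBounded_iff_forall_norm_le.2 ⟨C, by rintro _ ⟨t, rfl⟩; exact hC t⟩

/-- If `L` factorizes on products `f * star g` with `f, g` in a closed subalgebra `S`, then it
acts on the unitaries `exp (f - star f)`, `f ∈ S`, like a multiple of a character. By Liouville's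
theorem, `t ↦ L (exp (t • f))` solves a linear differential equation. -/
theorem apply_exp_sub_star {A : Type*} [CommCStarAlgebra A] [Nontrivial A] (L : A →L[ℂ] ℂ)
    (S : Subalgebra ℂ A) (hS : IsClosed (S : Set A)) (h1 : L 1 ≠ 0)
    (hL : ∀ f ∈ S, ∀ g ∈ S, L 1 * L (f * star g) = L f * L (star g)) {f : A} (hf : f ∈ S) :
    L (NormedSpace.exp (f - star f)) = L 1 * Complex.exp (L f / L 1 - conj (L f / L 1)) := by
  let _ : NormedAlgebra ℚ A := NormedAlgebra.restrictScalars ℚ ℂ A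
  have hE : ∀ t : ℂ, NormedSpace.exp (t • f) ∈ S := fun t =>
    NormedSpace.exp_mem hS (S.smul_mem hf t)
  have hdE : ∀ t : ℂ, HasDerivAt (fun u : ℂ => NormedSpace.exp (u • f))
      (f * NormedSpace.exp (t • f)) t := fun t => hasDerivAt_exp_smul_const' f t
  set φ : ℂ → ℂ := fun t => L (NormedSpace.exp (t • f)) with hφ
  set φ' : ℂ → ℂ := fun t => L (f * NormedSpace.exp (t • f)) with hφ'
  set ψ : ℂ → ℂ := fun t => conjStar L (NormedSpace.exp ((-t) • f)) with hψ
  have dφ : ∀ t, HasDerivAt φ (φ' t) t := fun t =>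
    L.hasFDerivAt.comp_hasDerivAt t (hdE t)
  have dφ' : Differentiable ℂ φ' := fun t =>
    (L.hasFDerivAt.comp_hasDerivAt t ((hdE t).const_mul f)).differentiableAt
  have dψ : Differentiable ℂ ψ := fun t =>
    ((conjStar L).hasFDerivAt.comp_hasDerivAt t
      ((hdE (-t)).scomp t (hasDerivAt_neg t))).differentiableAt
  have hcov : ∀ g ∈ S, ∀ t : ℂ, L (g * NormedSpace.exp (t • f)) * conj (ψ t)
      = L 1 * L (g * NormedSpace.exp (t • f - star (t • f))) := by
    intro g hg t
    rw [← exp_mul_star_exp_neg, ← mul_assoc, hL _ (S.mul_mem hg (hE t)) _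
      (by simpa using hE (-t))]
    simp [hψ, conjStar_apply]
  have hbd : ∀ g ∈ S, ∀ t : ℂ, ‖L (g * NormedSpace.exp (t • f)) * ψ t‖
      ≤ ‖L 1‖ * (‖L‖ * ‖g‖) := by
    intro g hg t
    have := hcov g hg t
    calc _ = ‖L (g * NormedSpace.exp (t • f)) * conj (ψ t)‖ := by simp
      _ = ‖L 1‖ * ‖L (g * NormedSpace.exp (t • f - star (t • f)))‖ := by
        rw [this, norm_mul]
      _ ≤ _ := by
        gcongr
        refine (L.le_opNorm _).trans ?_
        gcongr
        refine (norm_mul_le _ _).trans ?_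
        rw [norm_exp_sub_star, mul_one]
  have dφd : Differentiable ℂ φ := fun t => (dφ t).differentiableAt
  have c0 : ∀ t, φ t * ψ t = L 1 * conj (L 1) := by
    intro t
    have := eq_const_of_norm_le (dφd.mul dψ) (C := ‖L 1‖ * (‖L‖ * ‖(1 : A)‖))
      (fun t => by simpa only [one_mul, Pi.mul_apply] using hbd 1 S.one_mem t) t
    simpa [hφ, hψ, conjStar_apply] using this
  have c1 : ∀ t, φ' t * ψ t = L f * conj (L 1) := by
    intro t
    have := eq_const_of_norm_le (dφ'.mul dψ) (hbd f hf) t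
    simpa [hφ', hψ, conjStar_apply] using this
  have h1' : conj (L 1) ≠ 0 := by simpa using h1
  have hψ0 : ∀ t, ψ t ≠ 0 := fun t h0 => by
    have := c0 t
    rw [h0, mul_zero] at this
    exact mul_ne_zero h1 h1' this.symm
  set w := L f / L 1 with hw
  have hode : ∀ t, φ' t = φ t * w := by
    intro t
    apply mul_right_cancel₀ (hψ0 t)
    rw [c1, mul_right_comm, c0, hw]
    field_simp
  have hφe : ∀ t, φ t = L 1 * Complex.exp (t * w) := by
    have hd : ∀ t, HasDerivAt (fun t => φ t * Complex.exp (-(t * w))) 0 t := by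
      intro t
      have := (dφ t).mul (((hasDerivAt_id t).mul_const w).neg.cexp)
      refine HasDerivAt.congr_deriv (f := fun t => φ t * Complex.exp (-(t * w))) this ?_
      rw [hode]
      ring
    intro t
    have := is_const_of_deriv_eq_zero (fun t => (hd t).differentiableAt)
      (fun t => (hd t).deriv) t 0
    simp only [zero_mul, neg_zero, Complex.exp_zero, mul_one, Complex.exp_neg] at this
    rw [← div_eq_mul_inv, div_eq_iff (Complex.exp_ne_zero _)] at this
    simpa [hφ] using this
  have hψ1 : ψ 1 = conj (L 1) * Complex.exp (-w) := by
    have := c0 1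
    rw [hφe, one_mul, mul_assoc] at this
    have := mul_left_cancel₀ h1 this
    rw [← this, Complex.exp_neg]
    field_simp [Complex.exp_ne_zero]
  have := hcov 1 S.one_mem 1
  simp only [one_mul, one_smul, hψ1] at this
  have h2 := hφe 1
  simp only [hφ, one_smul, one_mul] at h2
  rw [h2] at this
  apply mul_left_cancel₀ h1
  rw [← this, sub_eq_add_neg, Complex.exp_add]
  simp [← Complex.exp_conj]
  ring

/-- A functional on `C(K, ℂ)` which factorizes on `S * star S` and agrees with a multiple of
evaluation at `ζ` on a point-separating subspace of `S` is that multiple of the evaluation. -/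
theorem eq_smul_eval {K : Type*} [TopologicalSpace K] [CompactSpace K] (L : C(K, ℂ) →L[ℂ] ℂ)
    (S : Subalgebra ℂ C(K, ℂ)) (hS : IsClosed (S : Set C(K, ℂ))) (h1 : L 1 ≠ 0)
    (hL : ∀ f ∈ S, ∀ g ∈ S, L 1 * L (f * star g) = L f * L (star g))
    (V : Submodule ℂ C(K, ℂ)) (hVS : ∀ f ∈ V, f ∈ S)
    (hsep : ∀ x y : K, x ≠ y → ∃ f ∈ V, f x ≠ f y) (ζ : K)
    (hζ : ∀ f ∈ V, L f = L 1 * f ζ) (f : C(K, ℂ)) : L f = L 1 * f ζ := by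
  have : Nonempty K := ⟨ζ⟩
  let _ : NormedAlgebra ℚ C(K, ℂ) := NormedAlgebra.restrictScalars ℚ ℂ _
  have heval : ∀ (g : C(K, ℂ)) (x : K), NormedSpace.exp g x = Complex.exp (g x) := by
    intro g x
    rw [Complex.exp_eq_exp_ℂ]
    exact NormedSpace.map_exp (ContinuousMap.evalAlgHom ℂ ℂ x)
      (continuous_eval_const x) g
  let T : Submonoid C(K, ℂ) :=
    { carrier := (fun f => NormedSpace.exp (f - star f)) '' (V : Set C(K, ℂ))
      one_mem' := ⟨0, V.zero_mem, by simp⟩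
      mul_mem' := by
        rintro _ _ ⟨f, hf, rfl⟩ ⟨g, hg, rfl⟩
        refine ⟨f + g, V.add_mem hf hg, ?_⟩
        simp only [← NormedSpace.exp_add, star_add]
        congr 1
        ring }
  have hstar : star (T : Set C(K, ℂ)) ⊆ T := by
    rintro x ⟨f, hf, hx⟩
    refine ⟨-f, V.neg_mem hf, ?_⟩
    rw [← star_star x, ← hx]
    simp only [NormedSpace.star_exp, star_sub, star_neg, star_star]
    congr 1
    ring
  let B := StarAlgebra.adjoin ℂ (T : Set C(K, ℂ))
  let M : C(K, ℂ) →L[ℂ] ℂ := L - L 1 • ContinuousMap.evalCLM ℂ ζ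
  have hM : ∀ g, M g = L g - L 1 * g ζ := fun g => by simp [M]
  have hTM : ∀ x ∈ T, M x = 0 := by
    rintro _ ⟨g, hg, rfl⟩
    simp only [hM]
    rw [apply_exp_sub_star L S hS h1 hL (hVS g hg), heval, hζ g hg, mul_div_cancel_left₀ _ h1]
    simp
  have hBM : (B : Set C(K, ℂ)) ⊆ {x | M x = 0} := by
    intro x hx
    have hx' : x ∈ B.toSubalgebra := hx
    rw [StarAlgebra.adjoin_toSubalgebra, Set.union_eq_left.2 hstar, ← Subalgebra.mem_toSubmodule,
      Algebra.adjoin_eq_span, Submonoid.closure_eq] at hx'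
    have : Submodule.span ℂ (T : Set C(K, ℂ)) ≤ LinearMap.ker (M : C(K, ℂ) →ₗ[ℂ] ℂ) :=
      Submodule.span_le.2 hTM
    exact this hx'
  have hBsep : B.toSubalgebra.SeparatesPoints := by
    intro x y hxy
    obtain ⟨g, hg, hne⟩ := hsep x y hxy
    have hd : g x - g y ≠ 0 := sub_ne_zero.2 hne
    set u := (I / (g x - g y)) • g with hu
    have huV : u ∈ V := V.smul_mem _ hg
    refine ⟨_, ⟨_, StarAlgebra.subset_adjoin ℂ _ ⟨u, huV, rfl⟩, rfl⟩, ?_⟩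
    have hudiff : u x - u y = I := by
      simp only [hu, ContinuousMap.smul_apply, smul_eq_mul, ← mul_sub]
      field_simp
    simp only [heval]
    intro heq
    have h3 : Complex.exp (2 * I) = 1 := by
      have h4 : (u - star u) x = (u - star u) y + 2 * I := by
        have h5 : u x = u y + I := by rw [← hudiff]; ring
        simp only [ContinuousMap.sub_apply, ContinuousMap.star_apply, h5, star_add]
        simp
        ring
      rw [h4, Complex.exp_add] at heq
      exact mul_left_cancel₀ (Complex.exp_ne_zero _) (heq.trans (mul_one _).symm)
    obtain ⟨n, hn⟩ := Complex.exp_eq_one_iff.1 h3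
    have h6 : (1 : ℝ) = n * Real.pi := by
      have := congrArg Complex.im hn
      simp at this
      linarith
    have hpi := Real.pi_gt_three
    rcases le_or_gt n 0 with hn0 | hn0
    · have : (n : ℝ) ≤ 0 := by exact_mod_cast hn0
      nlinarith
    · have : (1 : ℝ) ≤ n := by exact_mod_cast hn0
      nlinarith
  have htop := ContinuousMap.starSubalgebra_topologicalClosure_eq_top_of_separatesPoints B hBsep
  have hf : f ∈ closure (B : Set C(K, ℂ)) := by
    rw [← StarSubalgebra.topologicalClosure_coe, htop]
    trivial
  have := closure_minimal hBM (isClosed_eq M.continuous continuous_const) hf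
  rw [Set.mem_ofPred_eq, hM] at this
  exact sub_eq_zero.1 this

/-- Integration against `h • P` as a continuous functional on `C(K, ℂ)`, for `P` carried by `K`. -/
theorem exists_integral_clm {E : Type*} [TopologicalSpace E] [T2Space E]
    [MeasurableSpace E] [BorelSpace E]
    (P : Measure E) [IsFiniteMeasure P] {h : E → ℂ} (hmeas : Measurable h)
    (hnorm : ∀ z, ‖h z‖ = 1) {K : Set E} (hK : IsCompact K) (hPK : P Kᶜ = 0) :
    ∃ L : C(K, ℂ) →L[ℂ] ℂ, ∀ (F : E → ℂ) (f : C(K, ℂ)), (∀ x : K, f x = F x) →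
      L f = ∫ z, F z * h z ∂P := by
  have : CompactSpace K := isCompact_iff_compactSpace.1 hK
  set Q := P.comap (Subtype.val : K → E) with hQ
  have hint : ∀ f : C(K, ℂ), Integrable (fun x : K => f x * h x) Q := by
    intro f
    refine Integrable.of_bound (f.continuous.measurable.mul
      (hmeas.comp measurable_subtype_coe)).aestronglyMeasurable ‖f‖ (ae_of_all _ fun x => ?_)
    rw [norm_mul, hnorm, mul_one]
    exact f.norm_coe_le_norm x
  let L₀ : C(K, ℂ) →ₗ[ℂ] ℂ :=
    { toFun := fun f => ∫ x : K, f x * h x ∂Q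
      map_add' := fun f g => by
        simp only [ContinuousMap.add_apply, add_mul]
        exact integral_add (hint f) (hint g)
      map_smul' := fun c f => by
        simp only [ContinuousMap.smul_apply, smul_eq_mul, mul_assoc, RingHom.id_apply]
        exact integral_const_mul _ _ }
  refine ⟨L₀.mkContinuous (Q.real Set.univ) fun f => ?_, fun F f hf => ?_⟩
  · rw [mul_comm]
    refine norm_integral_le_of_norm_le_const (ae_of_all _ fun x => ?_)
    rw [norm_mul, hnorm, mul_one]
    exact f.norm_coe_le_norm x
  · change ∫ x : K, f x * h x ∂Q = _
    simp only [hf]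
    rw [hQ, integral_subtype_comap hK.measurableSet (fun z => F z * h z),
      Measure.restrict_eq_self_of_ae_mem]
    exact hPK

/-- A complex measure `h • P` that integrates continuous functions like `c • δ_ζ` is `c • δ_ζ`. -/
theorem setIntegral_eq_of_forall_continuous {E : Type*} [PseudoEMetricSpace E]
    [MeasurableSpace E] [BorelSpace E] (P : Measure E) [IsFiniteMeasure P] {h : E → ℂ}
    (hmeas : Measurable h) (hnorm : ∀ z, ‖h z‖ = 1) (c : ℂ) (ζ : E)
    (hc : ∀ F : E → ℂ, Continuous F → ∫ z, F z * h z ∂P = c * F ζ)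
    {s : Set E} (hs : MeasurableSet s) :
    ∫ z in s, h z ∂P = if ζ ∈ s then c else 0 := by
  set G : E → ℂ := s.indicator 1 with hG
  have hGm : Measurable G := measurable_one.indicator hs
  have hGi : Integrable G (P + Measure.dirac ζ) :=
    (integrable_const (1 : ℂ)).indicator hs
  have e1 : ∫ z in s, h z ∂P = ∫ z, G z * h z ∂P := by
    rw [← integral_indicator hs]
    congr 1 with z
    by_cases hz : z ∈ s <;> simp [hG, hz]
  have e2 : (if ζ ∈ s then c else 0) = c * G ζ := by
    by_cases hz : ζ ∈ s <;> simp [hG, hz]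
  rw [e1, e2, ← sub_eq_zero, ← norm_le_zero_iff]
  refine le_of_forall_pos_le_add fun ε hε => ?_
  have hpos : 0 < 1 + ‖c‖ := by positivity
  obtain ⟨g, hg, hgi⟩ := hGi.exists_boundedContinuous_integral_sub_le (div_pos hε hpos)
  have hd : Integrable (fun x => ‖G x - g x‖) (P + Measure.dirac ζ) := (hGi.sub hgi).norm
  rw [integral_add_measure (hd.mono_measure (Measure.le_add_right le_rfl))
    (hd.mono_measure (Measure.le_add_left le_rfl)),
    integral_dirac' (fun x => ‖G x - g x‖) ζ
      (hGm.sub g.continuous.measurable).norm.stronglyMeasurable] at hg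
  have bd : ∀ f : E → ℂ, Integrable f P → Integrable (fun z => f z * h z) P := fun f hf =>
    hf.mul_bdd hmeas.aestronglyMeasurable (ae_of_all _ fun z => (hnorm z).le)
  have iG := bd G (hGi.mono_measure (Measure.le_add_right le_rfl))
  have ig := bd g (hgi.mono_measure (Measure.le_add_right le_rfl))
  have key : (∫ z, G z * h z ∂P) - c * G ζ
      = (∫ z, (G z - g z) * h z ∂P) - c * (G ζ - g ζ) := by
    simp only [sub_mul]
    rw [integral_sub iG ig, hc g g.continuous]
    ring
  have n1 : ‖∫ z, (G z - g z) * h z ∂P‖ ≤ ∫ z, ‖G z - g z‖ ∂P := by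
    refine (norm_integral_le_integral_norm _).trans_eq ?_
    simp [hnorm]
  have p1 : 0 ≤ ∫ z, ‖G z - g z‖ ∂P := integral_nonneg fun _ => norm_nonneg _
  have p2 := norm_nonneg (G ζ - g ζ)
  rw [key, zero_add]
  calc _ ≤ ‖∫ z, (G z - g z) * h z ∂P‖ + ‖c * (G ζ - g ζ)‖ := norm_sub_le _ _
    _ ≤ (∫ z, ‖G z - g z‖ ∂P) + ‖c‖ * ‖G ζ - g ζ‖ := by rw [norm_mul]; gcongr
    _ ≤ (1 + ‖c‖) * ((∫ z, ‖G z - g z‖ ∂P) + ‖G ζ - g ζ‖) := by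
      nlinarith [norm_nonneg c, mul_nonneg (norm_nonneg c) p1]
    _ ≤ (1 + ‖c‖) * (ε / (1 + ‖c‖)) := by gcongr
    _ = ε := by field_simp

/-- Factorization on monomials extends to the closed subalgebra they generate. -/
theorem covariance_on_closure {A ι : Type*} [CommCStarAlgebra A] (L : A →L[ℂ] ℂ) (x : ι → A)
    (hx : ∀ m n : ι →₀ ℕ, L 1 * L ((n.prod fun i k => x i ^ k) * star (m.prod fun i k => x i ^ k))
      = L (n.prod fun i k => x i ^ k) * L (star (m.prod fun i k => x i ^ k))) :
    ∀ f ∈ (Algebra.adjoin ℂ (Set.range x)).topologicalClosure,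
      ∀ g ∈ (Algebra.adjoin ℂ (Set.range x)).topologicalClosure,
      L 1 * L (f * star g) = L f * L (star g) := by
  have h0 : ∀ p q : MvPolynomial ι ℂ, L 1 * L (MvPolynomial.aeval x p
      * star (MvPolynomial.aeval x q)) =
      L (MvPolynomial.aeval x p) * L (star (MvPolynomial.aeval x q)) := by
    intro p q
    induction p using MvPolynomial.induction_on' with
    | add p₁ p₂ h₁ h₂ => simp only [map_add, add_mul, mul_add, h₁, h₂]
    | monomial n a =>
      induction q using MvPolynomial.induction_on' with
      | add q₁ q₂ h₁ h₂ => simp only [map_add, star_add, mul_add, h₁, h₂]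
      | monomial m b =>
        simp only [MvPolynomial.aeval_monomial, ← Algebra.smul_def, star_smul, smul_mul_assoc,
          mul_smul_comm, map_smul, smul_eq_mul]
        linear_combination a * star b * hx m n
  have h1 : ∀ f ∈ Algebra.adjoin ℂ (Set.range x), ∀ g ∈ Algebra.adjoin ℂ (Set.range x),
      L 1 * L (f * star g) = L f * L (star g) := by
    rw [Algebra.adjoin_range_eq_range_aeval]
    rintro _ ⟨p, rfl⟩ _ ⟨q, rfl⟩
    exact h0 p q
  intro f hf g hg
  have h2 : ∀ g ∈ Algebra.adjoin ℂ (Set.range x), L 1 * L (f * star g) = L f * L (star g) :=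
    fun g hg => closure_minimal (s := (Algebra.adjoin ℂ (Set.range x) : Set A))
      (fun f hf => h1 f hf g hg) (isClosed_eq (by fun_prop) (by fun_prop)) hf
  exact closure_minimal (s := (Algebra.adjoin ℂ (Set.range x) : Set A)) h2
    (isClosed_eq (by fun_prop) (by fun_prop)) hg

/-- A compactly supported complex measure `h • P` on `ℂ^d` with nonzero mass
satisfying the covariance equation equals `c·δ_ζ` with `c = μ(ℂ^d)` and the
`j`-th coordinate of `ζ` the normalized `j`-th first moment of `μ`. -/
theorem stmt_16 (d : ℕ) (P : Measure (Fin d → ℂ)) [IsFiniteMeasure P]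
    (h : (Fin d → ℂ) → ℂ) (hmeas : Measurable h) (hnorm : ∀ z, ‖h z‖ = 1)
    (hsupp : ∃ K : Set (Fin d → ℂ), IsCompact K ∧ P Kᶜ = 0)
    (hmass : ∫ z, h z ∂P ≠ 0)
    (hcov : ∀ m n : Fin d → ℕ,
      (∫ z, h z ∂P) *
          ∫ z, (∏ i, z i ^ n i) * (∏ i, (starRingEnd ℂ) (z i) ^ m i) * h z ∂P
        = (∫ z, (∏ i, z i ^ n i) * h z ∂P) *
            ∫ z, (∏ i, (starRingEnd ℂ) (z i) ^ m i) * h z ∂P) :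
    ∀ s : Set (Fin d → ℂ), MeasurableSet s →
      ∫ z in s, h z ∂P =
        if (fun j => (∫ z, z j * h z ∂P) / (∫ z, h z ∂P)) ∈ s
        then ∫ z, h z ∂P else 0 := by
  obtain ⟨K₀, hK₀, hPK₀⟩ := hsupp
  set c := ∫ z, h z ∂P with hc
  set ζ : Fin d → ℂ := fun j => (∫ z, z j * h z ∂P) / c with hζ
  set K : Set (Fin d → ℂ) := insert ζ K₀ with hKdef
  have hK : IsCompact K := hK₀.insert ζ
  have hPK : P Kᶜ = 0 :=
    measure_mono_null (Set.compl_subset_compl.2 (Set.subset_insert _ _)) hPK₀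
  have : CompactSpace K := isCompact_iff_compactSpace.1 hK
  obtain ⟨L, hL⟩ := exists_integral_clm P hmeas hnorm hK hPK
  have hL1 : L 1 = c := by rw [hL (fun _ => 1) 1 (fun _ => rfl)]; simp [hc]
  let x : Fin d → C(K, ℂ) := fun i => ⟨fun z => (z : Fin d → ℂ) i,
    (continuous_apply i).comp continuous_subtype_val⟩
  have hmon : ∀ (n : Fin d →₀ ℕ) (z : K),
      (n.prod fun i k => x i ^ k) z = ∏ i, (z : Fin d → ℂ) i ^ n i := by
    intro n z
    rw [Finsupp.prod_fintype _ _ (fun i => pow_zero _), ContinuousMap.prod_apply]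
    rfl
  have hmon' : ∀ (n : Fin d →₀ ℕ) (z : K), star (n.prod fun i k => x i ^ k) z
      = ∏ i, (starRingEnd ℂ) ((z : Fin d → ℂ) i) ^ n i := by
    intro n z
    simp only [ContinuousMap.star_apply, hmon, star_prod, star_pow]
    rfl
  have hcovL := covariance_on_closure L x (fun m n => by
    rw [hL1, hL (fun z => (∏ i, z i ^ n i) * (∏ i, (starRingEnd ℂ) (z i) ^ m i)) _
      fun z => congrArg₂ (· * ·) (hmon n z) (hmon' m z),
      hL (fun z => ∏ i, z i ^ n i) _ (hmon n),
      hL (fun z => ∏ i, (starRingEnd ℂ) (z i) ^ m i) _ (hmon' m)]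
    exact hcov m n)
  let V : Submodule ℂ C(K, ℂ) := Submodule.span ℂ (Set.range x)
  intro s hs
  refine setIntegral_eq_of_forall_continuous P hmeas hnorm c ζ (fun F hF => ?_) hs
  have := eq_smul_eval L _ (Subalgebra.isClosed_topologicalClosure _) (by rwa [hL1]) hcovL V
    (fun f hf => Subalgebra.le_topologicalClosure _ (Algebra.span_le_adjoin ℂ _ hf))
    (fun y z hyz => ?_) ⟨ζ, Set.mem_insert _ _⟩ (fun f hf => ?_)
    ((⟨F, hF⟩ : C(Fin d → ℂ, ℂ)).restrict K)
  · rwa [hL1, hL F _ fun _ => rfl] at this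
  · obtain ⟨i, hi⟩ := Function.ne_iff.1 (Subtype.coe_injective.ne hyz)
    exact ⟨x i, Submodule.subset_span ⟨i, rfl⟩, hi⟩
  · induction hf using Submodule.span_induction with
    | mem f hf =>
      obtain ⟨i, rfl⟩ := hf
      rw [hL1, hL (fun z => z i) _ fun _ => rfl]
      exact (mul_div_cancel₀ _ hmass).symm
    | zero => simp
    | add f g _ _ hf hg => simp only [map_add, hf, hg, ContinuousMap.add_apply, mul_add]
    | smul a f _ hf =>
      simp only [map_smul, hf, ContinuousMap.smul_apply, smul_eq_mul]
      ring
end
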